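/- In the random-environment setup with a stationary, ergodic random environment η and a random walk X in the 'have your cookie and eat it' environment η started at 1, suppose that the expectation E_𝒫[ω(0)/(1 − ω(0))] of ω(0)/(1 − ω(0)) under the environment law 𝒫 is at most 2. Then for every x ∈ ℤ, almost surely X_n = x for infinitely many n; that is, for 𝒫-almost every environment the quenched process is recurrent. -/

import Mathlib

open MeasureTheory Filter

noncomputable section

/-- The hitting time of site `x` by the process `X`, with value `⊤` if `x` is never hit. -/
def hitTime {Ω : Type*} (X : ℕ → Ω → ℤ) (x : ℤ) (ω : Ω) : ℕ∞ :=
  ⨅ (n : ℕ) (_ : X n ω = x), (n : ℕ∞)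

/-- The natural filtration of the process `X` at time `n`. -/
def natSA {Ω : Type*} (X : ℕ → Ω → ℤ) (n : ℕ) : MeasurableSpace Ω :=
  ⨆ m ∈ Finset.range (n + 1), MeasurableSpace.comap (X m) ⊤

/-- The event `A_n` that before time `n` the walk has never jumped leftward from its
current site `X_n`. -/
def freshEvent {Ω : Type*} (X : ℕ → Ω → ℤ) (n : ℕ) : Set Ω :=
  {ω | ∀ m < n, ¬(X m ω = X n ω ∧ X (m + 1) ω = X m ω - 1)}

/-- A random walk in the "have your cookie and eat it" environment `env`. -/
structure IsCookieRW {Ω : Type*} [MeasurableSpace Ω] (P : Measure Ω)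
    (env : ℤ → ℝ) (X : ℕ → Ω → ℤ) : Prop where
  envRange : ∀ x : ℤ, env x ∈ Set.Ico (1 / 2 : ℝ) 1
  meas : ∀ n, Measurable (X n)
  steps : ∀ n : ℕ, ∀ᵐ ω ∂P, |X (n + 1) ω - X n ω| = 1
  cond : ∀ n : ℕ,
    (P[Set.indicator {ω | X (n + 1) ω = X n ω + 1} (fun _ => (1 : ℝ)) | natSA X n])
      =ᵐ[P]
    fun ω => env (X n ω) * Set.indicator (freshEvent X n) (fun _ => (1 : ℝ)) ω
      + (1 / 2) * Set.indicator (freshEvent X n)ᶜ (fun _ => (1 : ℝ)) ω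

/-- A random walk in a random "have your cookie and eat it" environment `η`. -/
structure IsCookieRWRE {Ω : Type*} [MeasurableSpace Ω] (P : Measure Ω)
    (η : Ω → ℤ → ℝ) (X : ℕ → Ω → ℤ) : Prop where
  envMeas : Measurable η
  envRange : ∀ᵐ ω ∂P, ∀ x : ℤ, η ω x ∈ Set.Ico (1 / 2 : ℝ) 1
  meas : ∀ n, Measurable (X n)
  steps : ∀ n : ℕ, ∀ᵐ ω ∂P, |X (n + 1) ω - X n ω| = 1
  cond : ∀ n : ℕ,
    (P[Set.indicator {ω | X (n + 1) ω = X n ω + 1} (fun _ => (1 : ℝ)) |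
        MeasurableSpace.comap η inferInstance ⊔ natSA X n])
      =ᵐ[P]
    fun ω => η ω (X n ω) * Set.indicator (freshEvent X n) (fun _ => (1 : ℝ)) ω
      + (1 / 2) * Set.indicator (freshEvent X n)ᶜ (fun _ => (1 : ℝ)) ω

theorem tendsto_average_setIntegral_comp_iterate {Ω α : Type*} [MeasurableSpace Ω]
    [MeasurableSpace α] {P : Measure Ω} [IsProbabilityMeasure P] {η : Ω → α} (hη : Measurable η)
    {T : α → α} (hT : Ergodic T (P.map η)) {φ : α → ℝ} (hφ : Measurable φ) {M : ℝ}
    (hM : ∀ a, |φ a| ≤ M) {B : Set Ω} (hB : MeasurableSet B) :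
    Tendsto (fun N : ℕ => (N : ℝ)⁻¹ * ∑ i ∈ Finset.range N, ∫ ω in B, φ (T^[i] (η ω)) ∂P) atTop
      (nhds (P.real B * ∫ a, φ a ∂(P.map η))) := by
  set μ := P.map η with hμ
  have : IsProbabilityMeasure μ := Measure.isProbabilityMeasure_map hη.aemeasurable
  have hηmp : MeasurePreserving η P μ := ⟨hη, rfl⟩
  have hTmp : MeasurePreserving T μ μ := hT.toMeasurePreserving
  have hφL : MemLp φ 2 μ := MemLp.of_bound hφ.aestronglyMeasurable M (Eventually.of_forall hM)
  let U : Lp ℝ 2 μ →ₗᵢ[ℝ] Lp ℝ 2 μ := Lp.compMeasurePreservingₗᵢ ℝ T hTmp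
  let V : Lp ℝ 2 μ →ₗᵢ[ℝ] Lp ℝ 2 P := Lp.compMeasurePreservingₗᵢ ℝ η hηmp
  have key := (U.toContinuousLinearMap).tendsto_birkhoffAverage_orthogonalProjection
    U.norm_toContinuousLinearMap_le hφL.toLp
  set g : Lp ℝ 2 μ := (((U.toContinuousLinearMap).eqLocus
    (1 : Lp ℝ 2 μ →L[ℝ] Lp ℝ 2 μ)).orthogonalProjectionOnto hφL.toLp : Lp ℝ 2 μ) with hg
  have hgU : U g = g := by
    exact (((U.toContinuousLinearMap).eqLocus
      (1 : Lp ℝ 2 μ →L[ℝ] Lp ℝ 2 μ)).orthogonalProjectionOnto hφL.toLp).2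
  obtain ⟨c, hc⟩ : ∃ c : ℝ, (g : α → ℝ) =ᵐ[μ] Function.const α c := by
    refine hT.ae_eq_const_of_ae_eq_comp_ae (Lp.aestronglyMeasurable g) ?_
    have h1 := Lp.coeFn_compMeasurePreserving g hTmp
    have h2 : Lp.compMeasurePreserving T hTmp g = g := hgU
    rw [h2] at h1
    exact h1.symm
  have hiter : ∀ i : ℕ, ((U.toContinuousLinearMap)^[i] hφL.toLp : Lp ℝ 2 μ)
      =ᵐ[μ] fun a => φ (T^[i] a) := by
    intro i
    induction i with
    | zero => simpa using hφL.coeFn_toLp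
    | succ i ih =>
      rw [Function.iterate_succ_apply']
      have h1 := Lp.coeFn_compMeasurePreserving ((U.toContinuousLinearMap)^[i] hφL.toLp) hTmp
      refine h1.trans ?_
      have h2 := hTmp.quasiMeasurePreserving.ae_eq_comp ih
      refine h2.trans (Eventually.of_forall fun a => ?_)
      simp [Function.iterate_succ_apply]
  have hlim : ∀ C : Set Ω, MeasurableSet C → Tendsto (fun N : ℕ => (N : ℝ)⁻¹ *
      ∑ i ∈ Finset.range N, ∫ ω in C, φ (T^[i] (η ω)) ∂P) atTop (nhds (P.real C * c)) := by
    intro C hC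
    let ℓ : Lp ℝ 2 μ →L[ℝ] ℝ :=
      (innerSL ℝ (indicatorConstLp 2 hC (measure_ne_top P C) (1 : ℝ))).comp
      V.toContinuousLinearMap
    have hℓ : ∀ f : Lp ℝ 2 μ, ∀ f' : α → ℝ, f =ᵐ[μ] f' → ℓ f = ∫ ω in C, f' (η ω) ∂P := by
      intro f f' hf
      have h0 : ℓ f = inner ℝ (indicatorConstLp 2 hC (measure_ne_top P C) (1 : ℝ)) (V f) := rfl
      rw [h0, L2.inner_indicatorConstLp_one]
      have h1 : (V f : Ω → ℝ) =ᵐ[P] f ∘ η := Lp.coeFn_compMeasurePreserving f hηmp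
      have h2 := hηmp.quasiMeasurePreserving.ae_eq_comp hf
      exact integral_congr_ae (ae_restrict_of_ae (h1.trans h2))
    have h1 := (ℓ.continuous.tendsto g).comp key
    have h2 : ℓ g = P.real C * c := by
      rw [hℓ g _ hc]
      simp
    rw [h2] at h1
    refine h1.congr fun N => ?_
    simp only [Function.comp, birkhoffAverage, birkhoffSum, map_smul, map_sum, smul_eq_mul, id]
    congr 1
    exact Finset.sum_congr rfl fun i _ => hℓ _ _ (hiter i)
  have hcφ : c = ∫ a, φ a ∂μ := by
    have h1 := hlim Set.univ MeasurableSet.univ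
    refine tendsto_nhds_unique (by simpa using h1) ?_
    refine tendsto_const_nhds.congr' ?_
    filter_upwards [eventually_gt_atTop 0] with N hN
    have h2 : ∀ i : ℕ, ∫ ω, φ (T^[i] (η ω)) ∂P = ∫ a, φ a ∂μ := by
      intro i
      have h3 := (hTmp.iterate i).comp hηmp
      rw [← h3.map_eq, integral_map h3.aemeasurable hφ.aestronglyMeasurable]
      rfl
    have : (N : ℝ) ≠ 0 := by positivity
    simp [h2]
    field_simp
  rw [← hcφ]
  exact hlim B hB

/-- The environment seen from the site `c`. -/
def envShift (c : ℤ) (e : ℤ → ℝ) : ℤ → ℝ := fun x => e (x + c)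

theorem measurable_envShift (c : ℤ) : Measurable (envShift c) :=
  measurable_pi_lambda _ fun x => measurable_pi_apply (x + c)

theorem envShift_envShift (c d : ℤ) (e : ℤ → ℝ) :
    envShift c (envShift d e) = envShift (c + d) e := by
  funext x; simp [envShift, add_assoc]

theorem iterate_shift_eq_envShift (i : ℕ) (e : ℤ → ℝ) :
    (fun e : ℤ → ℝ => fun x => e (x + 1))^[i] e = envShift i e := by
  induction i generalizing e with
  | zero => funext x; simp [envShift]
  | succ i ih =>
    rw [Function.iterate_succ_apply, ih]
    funext x
    simp only [envShift]
    congr 1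
    push_cast
    ring

open Classical in
/-- The probability of a jump to the right from `z`, when `S` is the set of sites that have
already been left by a jump to the left. -/
def rightWeight (e : ℤ → ℝ) (S : Set ℤ) (z : ℤ) : ENNReal :=
  if z ∈ S then 2⁻¹ else ENNReal.ofReal (e z)

open Classical in
/-- The probability of a jump to the left from `z`, when `S` is the set of sites that have
already been left by a jump to the left. -/
def leftWeight (e : ℤ → ℝ) (S : Set ℤ) (z : ℤ) : ENNReal :=
  if z ∈ S then 2⁻¹ else ENNReal.ofReal (1 - e z)

/-- The quenched probability that the walk at `z`, with `S` the set of sites already left by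
a jump to the left, stays in `[0, ∞)` for the next `n` steps. -/
def stayProb (e : ℤ → ℝ) : ℕ → Set ℤ → ℤ → ENNReal
  | 0, _, _ => 1
  | n + 1, S, z => rightWeight e S z * stayProb e n S (z + 1) +
      leftWeight e S z * if 0 < z then stayProb e n (insert z S) (z - 1) else 0

/-- The quenched probability that the walk at `z`, with `S` the set of sites already left by
a jump to the left, stays in `[0, ∞)` forever. -/
def stayForeverProb (e : ℤ → ℝ) (S : Set ℤ) (z : ℤ) : ENNReal := ⨅ n, stayProb e n S z

theorem measurable_rightWeight (S : Set ℤ) (z : ℤ) : Measurable fun e => rightWeight e S z := by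
  unfold rightWeight
  split_ifs
  · exact measurable_const
  · exact (measurable_pi_apply z).ennreal_ofReal

theorem measurable_leftWeight (S : Set ℤ) (z : ℤ) : Measurable fun e => leftWeight e S z := by
  unfold leftWeight
  split_ifs
  · exact measurable_const
  · exact (measurable_const.sub (measurable_pi_apply z)).ennreal_ofReal

theorem measurable_stayProb (n : ℕ) (S : Set ℤ) (z : ℤ) :
    Measurable fun e => stayProb e n S z := by
  induction n generalizing S z with
  | zero => exact measurable_const
  | succ n ih =>
    simp only [stayProb]
    refine ((measurable_rightWeight S z).mul (ih _ _)).add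
      ((measurable_leftWeight S z).mul ?_)
    split_ifs
    · exact ih _ _
    · exact measurable_const

theorem measurable_stayForeverProb (S : Set ℤ) (z : ℤ) :
    Measurable fun e => stayForeverProb e S z :=
  Measurable.iInf fun n => measurable_stayProb n S z

theorem stayForeverProb_le_one (e : ℤ → ℝ) (S : Set ℤ) (z : ℤ) : stayForeverProb e S z ≤ 1 :=
  iInf_le (fun n => stayProb e n S z) 0

section ValidEnvironment

variable {e : ℤ → ℝ} (he : ∀ x, e x ∈ Set.Ico (1 / 2 : ℝ) 1)
include he

theorem rightWeight_add_leftWeight (S : Set ℤ) (z : ℤ) :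
    rightWeight e S z + leftWeight e S z = 1 := by
  unfold rightWeight leftWeight
  split_ifs
  · exact ENNReal.inv_two_add_inv_two
  · have := he z
    rw [← ENNReal.ofReal_add (by linarith [this.1]) (by linarith [this.2])]
    simp

theorem rightWeight_pos (S : Set ℤ) (z : ℤ) : 0 < rightWeight e S z := by
  unfold rightWeight
  split_ifs
  · simp
  · exact ENNReal.ofReal_pos.2 (by linarith [(he z).1])

theorem leftWeight_pos (S : Set ℤ) (z : ℤ) : 0 < leftWeight e S z := by
  unfold leftWeight
  split_ifs
  · simp
  · exact ENNReal.ofReal_pos.2 (by linarith [(he z).2])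

theorem stayProb_succ_le (n : ℕ) (S : Set ℤ) (z : ℤ) :
    stayProb e (n + 1) S z ≤ stayProb e n S z := by
  induction n generalizing S z with
  | zero =>
    simp only [stayProb]
    calc _ ≤ rightWeight e S z * 1 + leftWeight e S z * 1 := by
          gcongr; split_ifs <;> simp
      _ = 1 := by rw [mul_one, mul_one, rightWeight_add_leftWeight he]
  | succ n ih =>
    conv_lhs => rw [stayProb]
    conv_rhs => rw [stayProb]
    refine add_le_add (mul_le_mul' le_rfl (ih _ _)) (mul_le_mul' le_rfl ?_)
    split_ifs
    · exact ih _ _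
    · exact le_rfl

theorem stayProb_antitone (S : Set ℤ) (z : ℤ) : Antitone fun n => stayProb e n S z :=
  antitone_nat_of_succ_le fun n => stayProb_succ_le he n S z

theorem rightWeight_mul_le (S : Set ℤ) (z : ℤ) :
    rightWeight e S z * stayForeverProb e S (z + 1) ≤ stayForeverProb e S z := by
  refine le_iInf fun n => ?_
  cases n with
  | zero =>
    calc _ ≤ 1 * 1 := mul_le_mul' (by rw [← rightWeight_add_leftWeight he S z]; exact le_self_add)
          (stayForeverProb_le_one _ _ _)
      _ = _ := by simp [stayProb]
  | succ n =>
    rw [stayProb]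
    exact le_add_right (mul_le_mul' le_rfl (iInf_le _ n))

theorem leftWeight_mul_le (S : Set ℤ) {z : ℤ} (hz : 0 < z) :
    leftWeight e S z * stayForeverProb e (insert z S) (z - 1) ≤ stayForeverProb e S z := by
  refine le_iInf fun n => ?_
  cases n with
  | zero =>
    calc _ ≤ 1 * 1 := mul_le_mul' (by rw [← rightWeight_add_leftWeight he S z]; exact le_add_self)
          (stayForeverProb_le_one _ _ _)
      _ = _ := by simp [stayProb]
  | succ n =>
    rw [stayProb, if_pos hz]
    exact le_add_left (mul_le_mul' le_rfl (iInf_le _ n))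

theorem stayForeverProb_pos_of_right {S : Set ℤ} {z : ℤ} (h : 0 < stayForeverProb e S (z + 1)) :
    0 < stayForeverProb e S z :=
  (ENNReal.mul_pos (rightWeight_pos he S z).ne' h.ne').trans_le (rightWeight_mul_le he S z)

theorem stayForeverProb_pos_of_left {S : Set ℤ} {z : ℤ} (hz : 0 < z)
    (h : 0 < stayForeverProb e (insert z S) (z - 1)) : 0 < stayForeverProb e S z :=
  (ENNReal.mul_pos (leftWeight_pos he S z).ne' h.ne').trans_le (leftWeight_mul_le he S hz)

end ValidEnvironment

theorem stayProb_envShift_le {c : ℤ} (hc : 0 ≤ c) (e : ℤ → ℝ) (n : ℕ) (S : Set ℤ) (z : ℤ) :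
    stayProb (envShift c e) n ((· + c) ⁻¹' S) z ≤ stayProb e n S (z + c) := by
  induction n generalizing S z with
  | zero => exact le_rfl
  | succ n ih =>
    rw [stayProb, stayProb]
    have hr : rightWeight (envShift c e) ((· + c) ⁻¹' S) z = rightWeight e S (z + c) := rfl
    have hl : leftWeight (envShift c e) ((· + c) ⁻¹' S) z = leftWeight e S (z + c) := rfl
    have hins : insert z ((· + c) ⁻¹' S) = (· + c) ⁻¹' (insert (z + c) S) := by
      ext w; simp
    rw [hr, hl]
    gcongr
    · rw [add_right_comm]
      exact ih S (z + 1)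
    · by_cases hz : 0 < z
      · rw [if_pos hz, if_pos (by omega), hins]
        rw [add_sub_right_comm]
        exact ih (insert (z + c) S) (z - 1)
      · simp [hz]

theorem stayForeverProb_envShift_le {c : ℤ} (hc : 0 ≤ c) (e : ℤ → ℝ) (S : Set ℤ) (z : ℤ) :
    stayForeverProb (envShift c e) ((· + c) ⁻¹' S) z ≤ stayForeverProb e S (z + c) :=
  iInf_mono fun n => stayProb_envShift_le hc e n S z

/-- If the walk can survive above `1` after having explored `[1, r]`, then it can survive
above `0` from a fresh start. -/
theorem stayForeverProb_empty_pos {e : ℤ → ℝ} (he : ∀ x, e x ∈ Set.Ico (1 / 2 : ℝ) 1) (r : ℕ)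
    (h : 0 < stayForeverProb (envShift 1 e) (Set.Ico 0 (r : ℤ)) 0) :
    0 < stayForeverProb e ∅ 0 := by
  have h1 : 0 < stayForeverProb e (Set.Icc 1 (r : ℤ)) 1 := by
    refine h.trans_le ?_
    have h2 := stayForeverProb_envShift_le zero_le_one e (Set.Icc 1 (r : ℤ)) 0
    have h3 : (· + 1) ⁻¹' Set.Icc 1 (r : ℤ) = Set.Ico 0 (r : ℤ) := by
      ext w
      simp only [Set.mem_preimage, Set.mem_Icc, Set.mem_Ico]
      omega
    rwa [h3, zero_add] at h2
  have h2 : ∀ j : ℕ, j ≤ r → 0 < stayForeverProb e (Set.Icc ((j : ℤ) + 1) r) j := by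
    intro j
    induction j with
    | zero => intro _; exact stayForeverProb_pos_of_right he (by simpa using h1)
    | succ j ih =>
      intro hj
      refine stayForeverProb_pos_of_left he (by push_cast; omega) ?_
      convert ih (by omega) using 2
      · ext w; simp; omega
      · push_cast; ring
  have h3 : ∀ j : ℕ, j ≤ r → 0 < stayForeverProb e ∅ ((r : ℤ) - j) := by
    intro j
    induction j with
    | zero => intro _; convert h2 r le_rfl using 2 <;> simp
    | succ j ih =>
      intro hj
      refine stayForeverProb_pos_of_right he ?_
      convert ih (by omega) using 2
      push_cast; ring
  simpa using h3 r le_rfl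

theorem measurableSet_of_history {Ω : Type*} {m : MeasurableSpace Ω} {X : ℕ → Ω → ℤ} {n : ℕ}
    (hX : ∀ j ≤ n, Measurable (X j)) {S : Set Ω}
    (hS : ∀ ω ω', (∀ j ≤ n, X j ω = X j ω') → ω ∈ S → ω' ∈ S) : MeasurableSet S := by
  let g : Ω → (Fin (n + 1) → ℤ) := fun ω j => X j ω
  have hg : Measurable g := measurable_pi_lambda _ fun j => hX j (Nat.lt_succ_iff.1 j.2)
  have hSg : S = g ⁻¹' (g '' S) := by
    refine (Set.subset_preimage_image g S).antisymm ?_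
    rintro ω' ⟨ω, hω, hωω'⟩
    refine hS ω ω' (fun j hj => ?_) hω
    exact congrFun hωω' ⟨j, Nat.lt_succ_iff.2 hj⟩
  rw [hSg]
  exact hg (Set.to_countable _).measurableSet

theorem measurable_eval_comp {Ω : Type*} {m : MeasurableSpace Ω} {η : Ω → ℤ → ℝ} {Y : Ω → ℤ}
    (hη : Measurable η) (hY : Measurable Y) : Measurable fun ω => η ω (Y ω) := by
  have h : Measurable fun p : (ℤ → ℝ) × ℤ => p.1 p.2 :=
    measurable_from_prod_countable_left fun z => measurable_pi_apply z
  exact h.comp (hη.prodMk hY)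

open Classical in
/-- The quenched probability that the walk jumps to the right at time `n`, given its past. -/
def rightProb {Ω : Type*} (η : Ω → ℤ → ℝ) (X : ℕ → Ω → ℤ) (n : ℕ) (ω : Ω) : ℝ :=
  if ω ∈ freshEvent X n then η ω (X n ω) else 1 / 2

/-- The event that the walk stays at or above the level `y` between the times `m` and
`m + n`. -/
def stayEvent {Ω : Type*} (X : ℕ → Ω → ℤ) (y : ℤ) (m n : ℕ) : Set Ω :=
  {ω | ∀ i ≤ n, y ≤ X (m + i) ω}

/-- The event that at time `m` the walk is at `y + z`, and that among the sites at or above `y`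
exactly those of `y + S` have been left by a jump to the left before time `m`. -/
def stateEvent {Ω : Type*} (X : ℕ → Ω → ℤ) (y : ℤ) (m : ℕ) (S : Set ℤ) (z : ℤ) : Set Ω :=
  {ω | X m ω = y + z ∧
    ∀ w, 0 ≤ w → (w ∈ S ↔ ∃ j < m, X j ω = y + w ∧ X (j + 1) ω = y + w - 1)}

theorem lintegral_of_condExp_indicator {Ω : Type*} {m mΩ : MeasurableSpace Ω} {P : Measure Ω}
    [IsFiniteMeasure P] (hm : m ≤ mΩ) {R : Set Ω} (hR : MeasurableSet R) {q : Ω → ℝ}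
    (hq : Measurable q) (hq0 : ∀ᵐ ω ∂P, 0 ≤ q ω)
    (hcond : P[R.indicator (fun _ => (1 : ℝ)) | m] =ᵐ[P] q) {Z : Ω → ENNReal}
    (hZ : Measurable[m] Z) :
    ∫⁻ ω in R, Z ω ∂P = ∫⁻ ω, Z ω * ENNReal.ofReal (q ω) ∂P := by
  have hqi : Integrable q P := integrable_condExp.congr hcond
  have hmeas : (P.restrict R).trim hm = (P.withDensity fun ω => ENNReal.ofReal (q ω)).trim hm := by
    refine @Measure.ext _ m _ _ fun s hs => ?_
    rw [trim_measurableSet_eq hm hs, trim_measurableSet_eq hm hs, withDensity_apply _ (hm s hs),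
      Measure.restrict_apply (hm s hs),
      ← ofReal_integral_eq_lintegral_ofReal hqi.integrableOn (ae_restrict_of_ae hq0),
      ← integral_congr_ae (ae_restrict_of_ae hcond), setIntegral_condExp hm _ hs,
      setIntegral_indicator hR]
    · simp
    · exact (integrable_const 1).indicator hR
  rw [← lintegral_trim hm hZ, hmeas, lintegral_trim hm hZ,
    lintegral_withDensity_eq_lintegral_mul _ hq.ennreal_ofReal (hZ.mono hm le_rfl)]
  exact lintegral_congr fun ω => mul_comm _ _

namespace IsCookieRWRE

variable {Ω : Type*} [mΩ : MeasurableSpace Ω] {P : Measure Ω} {η : Ω → ℤ → ℝ}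
  {X : ℕ → Ω → ℤ} (h : IsCookieRWRE P η X)
include h

/-- The filtration generated by the environment and the past of the walk. -/
def filtration : Filtration ℕ mΩ where
  seq n := MeasurableSpace.comap η inferInstance ⊔ natSA X n
  mono' i j hij := by
    refine sup_le_sup le_rfl (iSup₂_le fun k hk => ?_)
    exact le_iSup₂ (f := fun k (_ : k ∈ Finset.range (j + 1)) => MeasurableSpace.comap (X k) ⊤) k
      (Finset.mem_range.2 (by have := Finset.mem_range.1 hk; omega))
  le' n := sup_le h.envMeas.comap_le (iSup₂_le fun k _ => (h.meas k).comap_le)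

theorem measurable_env (n : ℕ) : Measurable[h.filtration n] η :=
  Measurable.mono (comap_measurable η) le_sup_left le_rfl

theorem measurable_walk {j n : ℕ} (hj : j ≤ n) : Measurable[h.filtration n] (X j) := by
  refine Measurable.mono (comap_measurable (X j)) (le_trans ?_ le_sup_right) le_rfl
  exact le_iSup₂ (f := fun k (_ : k ∈ Finset.range (n + 1)) => MeasurableSpace.comap (X k) ⊤) j
    (Finset.mem_range.2 (by omega))

theorem measurableSet_of_history {n : ℕ} {S : Set Ω}
    (hS : ∀ ω ω', (∀ j ≤ n, X j ω = X j ω') → ω ∈ S → ω' ∈ S) :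
    MeasurableSet[h.filtration n] S :=
  _root_.measurableSet_of_history (fun _ hj => h.measurable_walk hj) hS

theorem measurableSet_freshEvent (n : ℕ) : MeasurableSet[h.filtration n] (freshEvent X n) := by
  refine h.measurableSet_of_history fun ω ω' hω hf m hm => ?_
  rw [← hω m hm.le, ← hω n le_rfl, ← hω (m + 1) hm]
  exact hf m hm

theorem measurable_rightProb (n : ℕ) : Measurable[h.filtration n] (rightProb η X n) :=
  Measurable.ite (h.measurableSet_freshEvent n)
    (measurable_eval_comp (h.measurable_env n) (h.measurable_walk le_rfl)) measurable_const

theorem rightProb_mem : ∀ᵐ ω ∂P, ∀ n, rightProb η X n ω ∈ Set.Ico (1 / 2 : ℝ) 1 := by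
  filter_upwards [h.envRange] with ω hω n
  unfold rightProb
  split_ifs
  · exact hω _
  · norm_num

theorem condExp_right (n : ℕ) :
    P[Set.indicator {ω | X (n + 1) ω = X n ω + 1} (fun _ => (1 : ℝ)) | h.filtration n]
      =ᵐ[P] rightProb η X n := by
  refine (h.cond n).trans (Eventually.of_forall fun ω => ?_)
  by_cases hω : ω ∈ freshEvent X n <;> simp [rightProb, hω]

theorem ae_steps : ∀ᵐ ω ∂P, ∀ n, X (n + 1) ω = X n ω + 1 ∨ X (n + 1) ω = X n ω - 1 := by
  filter_upwards [ae_all_iff.2 h.steps] with ω hω n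
  have := hω n
  rcases abs_eq (zero_le_one) |>.1 this with h1 | h1 <;> omega

theorem measurableSet_right (n : ℕ) : MeasurableSet {ω | X (n + 1) ω = X n ω + 1} :=
  measurableSet_eq_fun (h.meas _) ((h.meas _).add_const _)

theorem measurableSet_left (n : ℕ) : MeasurableSet {ω | X (n + 1) ω = X n ω - 1} :=
  measurableSet_eq_fun (h.meas _) ((h.meas _).sub_const _)

variable [IsProbabilityMeasure P]

theorem condExp_left (n : ℕ) :
    P[Set.indicator {ω | X (n + 1) ω = X n ω - 1} (fun _ => (1 : ℝ)) | h.filtration n]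
      =ᵐ[P] fun ω => 1 - rightProb η X n ω := by
  have h1 : Set.indicator {ω | X (n + 1) ω = X n ω - 1} (fun _ => (1 : ℝ)) =ᵐ[P]
      (fun _ => (1 : ℝ)) - Set.indicator {ω | X (n + 1) ω = X n ω + 1} (fun _ => (1 : ℝ)) := by
    filter_upwards [h.ae_steps] with ω hω
    rcases hω n with h2 | h2
    · have h3 : ¬ (X n ω + 1 = X n ω - 1) := by omega
      simp [h2, h3]
    · have h3 : ¬ (X n ω - 1 = X n ω + 1) := by omega
      simp [h2, h3]
  refine (condExp_congr_ae h1).trans ?_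
  refine (condExp_sub (integrable_const _)
    ((integrable_const _).indicator (h.measurableSet_right n)) _).trans ?_
  filter_upwards [h.condExp_right n] with ω hω
  rw [Pi.sub_apply, hω, condExp_const (h.filtration.le n)]

theorem setLIntegral_right (n : ℕ) {H : Set Ω} (hH : MeasurableSet[h.filtration n] H)
    {Z : Ω → ENNReal} (hZ : Measurable[h.filtration n] Z) :
    ∫⁻ ω in H ∩ {ω | X (n + 1) ω = X n ω + 1}, Z ω ∂P =
      ∫⁻ ω in H, Z ω * ENNReal.ofReal (rightProb η X n ω) ∂P := by
  have hle := h.filtration.le n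
  rw [← setLIntegral_indicator (hle _ hH), lintegral_of_condExp_indicator hle
    (h.measurableSet_right n) ((h.measurable_rightProb n).mono hle le_rfl)
    (h.rightProb_mem.mono fun ω hω => by linarith [(hω n).1]) (h.condExp_right n)
    (hZ.indicator hH), ← lintegral_indicator (hle _ hH)]
  exact lintegral_congr fun ω => by by_cases hω : ω ∈ H <;> simp [hω]

theorem setLIntegral_left (n : ℕ) {H : Set Ω} (hH : MeasurableSet[h.filtration n] H)
    {Z : Ω → ENNReal} (hZ : Measurable[h.filtration n] Z) :
    ∫⁻ ω in H ∩ {ω | X (n + 1) ω = X n ω - 1}, Z ω ∂P =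
      ∫⁻ ω in H, Z ω * ENNReal.ofReal (1 - rightProb η X n ω) ∂P := by
  have hle := h.filtration.le n
  rw [← setLIntegral_indicator (hle _ hH), lintegral_of_condExp_indicator hle
    (h.measurableSet_left n) (((h.measurable_rightProb n).mono hle le_rfl).const_sub 1)
    (h.rightProb_mem.mono fun ω hω => by linarith [(hω n).2]) (h.condExp_left n)
    (hZ.indicator hH), ← lintegral_indicator (hle _ hH)]
  exact lintegral_congr fun ω => by by_cases hω : ω ∈ H <;> simp [hω]

omit [IsProbabilityMeasure P] in
theorem measurableSet_stayEvent (y : ℤ) (m n : ℕ) : MeasurableSet (stayEvent X y m n) := by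
  refine _root_.measurableSet_of_history (n := m + n) (fun j _ => h.meas j)
    fun ω ω' hω hs i hi => ?_
  rw [← hω (m + i) (by omega)]
  exact hs i hi

/-- The quenched probability to stay above a level `y` is computed by `stayProb`, applied to
the environment seen from `y`. -/
theorem setLIntegral_stayEvent (y : ℤ) (n m : ℕ) (S : Set ℤ) {z : ℤ} (hz : 0 ≤ z) {H : Set Ω}
    (hH : MeasurableSet[h.filtration m] H) (hHs : H ⊆ stateEvent X y m S z)
    {f : (ℤ → ℝ) → ENNReal} (hf : Measurable f) :
    ∫⁻ ω in H ∩ stayEvent X y m n, f (η ω) ∂P =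
      ∫⁻ ω in H, f (η ω) * stayProb (envShift y (η ω)) n S z ∂P := by
  induction n generalizing m S z H with
  | zero =>
    have : H ∩ stayEvent X y m 0 = H := by
      refine Set.inter_eq_left.2 fun ω hω i hi => ?_
      obtain rfl : i = 0 := by omega
      have := (hHs hω).1
      simp only [add_zero]
      omega
    simp [this, stayProb]
  | succ n ih =>
    have hle := h.filtration.le m
    have hH1 : MeasurableSet[h.filtration (m + 1)] H := h.filtration.mono (Nat.le_succ m) _ hH
    set R := H ∩ {ω | X (m + 1) ω = X m ω + 1} with hR
    set L := H ∩ {ω | X (m + 1) ω = X m ω - 1} with hL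
    have hRm : MeasurableSet[h.filtration (m + 1)] R := hH1.inter <|
      h.measurableSet_of_history fun ω ω' hω hs => by
        simpa [← hω (m + 1) le_rfl, ← hω m (Nat.le_succ m)] using hs
    have hLm : MeasurableSet[h.filtration (m + 1)] L := hH1.inter <|
      h.measurableSet_of_history fun ω ω' hω hs => by
        simpa [← hω (m + 1) le_rfl, ← hω m (Nat.le_succ m)] using hs
    have hsplit : (H ∩ stayEvent X y m (n + 1) : Set Ω) =ᵐ[P]
        ((R ∩ stayEvent X y (m + 1) n) ∪ (L ∩ stayEvent X y (m + 1) n) : Set Ω) := by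
      filter_upwards [h.ae_steps] with ω hω
      refine propext ⟨fun hs => ?_, fun hs => ?_⟩
      · have h1 : ω ∈ stayEvent X y (m + 1) n := fun i hi => by
          have := hs.2 (i + 1) (by omega)
          rwa [show m + (i + 1) = m + 1 + i by ring] at this
        rcases hω m with h2 | h2
        · exact Or.inl ⟨⟨hs.1, h2⟩, h1⟩
        · exact Or.inr ⟨⟨hs.1, h2⟩, h1⟩
      · have h1 : ω ∈ H ∧ ω ∈ stayEvent X y (m + 1) n := by
          rcases hs with hs | hs
          · exact ⟨hs.1.1, hs.2⟩
          · exact ⟨hs.1.1, hs.2⟩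
        refine ⟨h1.1, fun i hi => ?_⟩
        cases i with
        | zero => have := (hHs h1.1).1; simp only [add_zero]; omega
        | succ i =>
          have := h1.2 i (by omega)
          rwa [show m + (i + 1) = m + 1 + i by ring]
    have hdisj : Disjoint (R ∩ stayEvent X y (m + 1) n) (L ∩ stayEvent X y (m + 1) n) := by
      refine Set.disjoint_left.2 fun ω h1 h2 => ?_
      have h3 : X (m + 1) ω = X m ω + 1 := h1.1.2
      have h4 : X (m + 1) ω = X m ω - 1 := h2.1.2
      omega
    have hfm : ∀ S' z', Measurable[h.filtration m] fun ω =>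
        f (η ω) * stayProb (envShift y (η ω)) n S' z' := fun S' z' =>
      (hf.mul ((measurable_stayProb n S' z').comp (measurable_envShift y))).comp
        (h.measurable_env m)
    have hfresh : ∀ ω ∈ H, (ω ∈ freshEvent X m ↔ z ∉ S) := fun ω hω => by
      obtain ⟨h1, h2⟩ := hHs hω
      rw [h2 z hz]
      simp only [freshEvent, Set.mem_ofPred_eq, h1]
      grind
    have hright : ∀ ω ∈ H, ENNReal.ofReal (rightProb η X m ω) =
        rightWeight (envShift y (η ω)) S z := fun ω hω => by
      have h1 := (hHs hω).1
      have h2 := hfresh ω hω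
      by_cases hzS : z ∈ S <;> simp [rightProb, rightWeight, envShift, h1, h2, hzS, add_comm y z]
    have hleft : ∀ ω ∈ H, ENNReal.ofReal (1 - rightProb η X m ω) =
        leftWeight (envShift y (η ω)) S z := fun ω hω => by
      have h1 := (hHs hω).1
      have h2 := hfresh ω hω
      have h3 : ENNReal.ofReal (1 - 2⁻¹) = 2⁻¹ := by
        rw [show (1 - 2⁻¹ : ℝ) = 2⁻¹ by norm_num]
        simp
      by_cases hzS : z ∈ S <;>
        simp [rightProb, leftWeight, envShift, h1, h2, h3, hzS, add_comm y z]
    have hRint : ∫⁻ ω in R ∩ stayEvent X y (m + 1) n, f (η ω) ∂P =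
        ∫⁻ ω in H, f (η ω) * (rightWeight (envShift y (η ω)) S z *
          stayProb (envShift y (η ω)) n S (z + 1)) ∂P := by
      rw [ih (m + 1) S (z := z + 1) (by omega) hRm, hR, h.setLIntegral_right m hH (hfm _ _)]
      · refine setLIntegral_congr_fun (hle _ hH) fun ω hω => ?_
        simp only [hright ω hω]
        ring
      · rintro ω ⟨hω, h3⟩
        obtain ⟨h1, h2⟩ := hHs hω
        have h3 : X (m + 1) ω = X m ω + 1 := h3
        refine ⟨by omega, fun w hw => ?_⟩
        rw [h2 w hw]
        refine ⟨fun ⟨j, hj, hj'⟩ => ⟨j, by omega, hj'⟩, fun ⟨j, hj, hj'⟩ => ⟨j, ?_, hj'⟩⟩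
        by_contra hjm
        obtain rfl : j = m := by omega
        omega
    have hLint : ∫⁻ ω in L ∩ stayEvent X y (m + 1) n, f (η ω) ∂P =
        ∫⁻ ω in H, f (η ω) * (leftWeight (envShift y (η ω)) S z *
          if 0 < z then stayProb (envShift y (η ω)) n (insert z S) (z - 1) else 0) ∂P := by
      by_cases hz0 : 0 < z
      · simp only [if_pos hz0]
        rw [ih (m + 1) (insert z S) (z := z - 1) (by omega) hLm, hL,
          h.setLIntegral_left m hH (hfm _ _)]
        · refine setLIntegral_congr_fun (hle _ hH) fun ω hω => ?_
          simp only [hleft ω hω]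
          ring
        · rintro ω ⟨hω, h3⟩
          obtain ⟨h1, h2⟩ := hHs hω
          have h3 : X (m + 1) ω = X m ω - 1 := h3
          refine ⟨by omega, fun w hw => ?_⟩
          rw [Set.mem_insert_iff, h2 w hw]
          constructor
          · rintro (rfl | ⟨j, hj, hj'⟩)
            · exact ⟨m, by omega, by omega, by omega⟩
            · exact ⟨j, by omega, hj'⟩
          · rintro ⟨j, hj, hj'⟩
            by_cases hjm : j = m
            · subst hjm
              left
              omega
            · exact Or.inr ⟨j, by omega, hj'⟩
      · have : L ∩ stayEvent X y (m + 1) n = ∅ := by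
          refine Set.eq_empty_of_forall_notMem fun ω hω => ?_
          have h1 := (hHs hω.1.1).1
          have h2 : X (m + 1) ω = X m ω - 1 := hω.1.2
          have h3 := hω.2 0 (by omega)
          simp only [add_zero] at h3
          omega
        simp [this, hz0]
    rw [setLIntegral_congr hsplit, lintegral_union
      ((h.filtration.le _ _ hLm).inter (h.measurableSet_stayEvent _ _ _)) hdisj, hRint, hLint,
      ← lintegral_add_left]
    · simp only [stayProb, mul_add]
    · refine (hf.comp h.envMeas).mul (Measurable.mul ?_ ?_)
      · exact ((measurable_rightWeight S z).comp (measurable_envShift y)).comp h.envMeas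
      · exact ((measurable_stayProb n S (z + 1)).comp (measurable_envShift y)).comp h.envMeas

end IsCookieRWRE

theorem exists_downcrossing {u : ℕ → ℤ} {a b : ℕ} {v : ℤ} (hab : a ≤ b)
    (hu : ∀ j < b, u (j + 1) = u j + 1 ∨ u (j + 1) = u j - 1) (ha : v ≤ u a) (hb : u b < v) :
    ∃ j, a ≤ j ∧ j < b ∧ u j = v ∧ u (j + 1) = v - 1 := by
  induction b, hab using Nat.le_induction with
  | base => omega
  | succ b hab ih =>
    by_cases h : u b < v
    · obtain ⟨j, h1, h2, h3⟩ := ih (fun j hj => hu j (by omega)) h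
      exact ⟨j, h1, by omega, h3⟩
    · have := hu b (by omega)
      exact ⟨b, hab, by omega, by omega, by omega⟩

theorem exists_first_hit {u : ℕ → ℤ} {a b : ℕ} {v : ℤ} (hab : a ≤ b)
    (hu : ∀ j < b, u (j + 1) = u j + 1 ∨ u (j + 1) = u j - 1) (ha : u a ≤ v) (hb : v ≤ u b) :
    ∃ j, a ≤ j ∧ j ≤ b ∧ u j = v ∧ ∀ i, a ≤ i → i < j → u i < v := by
  classical
  have hex : ∃ j, a ≤ j ∧ v ≤ u j := ⟨b, hab, hb⟩
  obtain ⟨h1, h2⟩ := Nat.find_spec hex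
  have hle : Nat.find hex ≤ b := Nat.find_min' hex ⟨hab, hb⟩
  have hmin : ∀ i, a ≤ i → i < Nat.find hex → u i < v := fun i hi hi' => by
    by_contra hcon
    exact Nat.find_min hex hi' ⟨hi, by omega⟩
  refine ⟨Nat.find hex, h1, hle, ?_, hmin⟩
  rcases h1.eq_or_lt with h3 | h3
  · rw [← h3] at h2 ⊢
    omega
  · have h4 := hmin (Nat.find hex - 1) (by omega) (by omega)
    have h5 := hu (Nat.find hex - 1) (by omega)
    rw [Nat.sub_add_cancel (by omega)] at h5
    omega

/-- The event that the walk never goes below `y` from time `m` on. -/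
def stayForeverEvent {Ω : Type*} (X : ℕ → Ω → ℤ) (y : ℤ) (m : ℕ) : Set Ω :=
  {ω | ∀ i, y ≤ X (m + i) ω}

namespace IsCookieRWRE

variable {Ω : Type*} [mΩ : MeasurableSpace Ω] {P : Measure Ω} {η : Ω → ℤ → ℝ}
  {X : ℕ → Ω → ℤ} (h : IsCookieRWRE P η X)
include h

theorem measurableSet_stayForeverEvent (y : ℤ) (m : ℕ) :
    MeasurableSet (stayForeverEvent X y m) := by
  simp only [stayForeverEvent, Set.ofPred_forall]
  exact MeasurableSet.iInter fun i => measurableSet_le measurable_const (h.meas _)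

variable [IsProbabilityMeasure P]

theorem setLIntegral_stayForeverEvent (y : ℤ) (m : ℕ) (S : Set ℤ) {z : ℤ} (hz : 0 ≤ z)
    {H : Set Ω} (hH : MeasurableSet[h.filtration m] H) (hHs : H ⊆ stateEvent X y m S z)
    {f : (ℤ → ℝ) → ENNReal} (hf : Measurable f) (hf1 : ∀ e, f e ≤ 1) :
    ∫⁻ ω in H ∩ stayForeverEvent X y m, f (η ω) ∂P =
      ∫⁻ ω in H, f (η ω) * stayForeverProb (envShift y (η ω)) S z ∂P := by
  have hH' := h.filtration.le m _ hH
  have hfη : Measurable fun ω => f (η ω) := hf.comp h.envMeas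
  have hfin : IsFiniteMeasure (P.withDensity fun ω => f (η ω)) := by
    refine isFiniteMeasure_withDensity (ne_top_of_le_ne_top ENNReal.one_ne_top ?_)
    calc ∫⁻ ω, f (η ω) ∂P ≤ ∫⁻ _, 1 ∂P := lintegral_mono fun ω => hf1 _
      _ = 1 := by simp
  have hmeas : ∀ n, MeasurableSet (H ∩ stayEvent X y m n) := fun n =>
    hH'.inter (h.measurableSet_stayEvent y m n)
  have hset : H ∩ stayForeverEvent X y m = ⋂ n, H ∩ stayEvent X y m n := by
    ext ω
    simp only [Set.mem_iInter, Set.mem_inter_iff]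
    exact ⟨fun hω n => ⟨hω.1, fun i _ => hω.2 i⟩, fun hω => ⟨(hω 0).1, fun i => (hω i).2 i le_rfl⟩⟩
  have hanti : Antitone fun n => H ∩ stayEvent X y m n := fun n n' hn ω hω =>
    ⟨hω.1, fun i hi => hω.2 i (hi.trans hn)⟩
  have h1 : Tendsto (fun n => ∫⁻ ω in H ∩ stayEvent X y m n, f (η ω) ∂P) atTop
      (nhds (∫⁻ ω in H ∩ stayForeverEvent X y m, f (η ω) ∂P)) := by
    have := tendsto_measure_iInter_atTop (μ := P.withDensity fun ω => f (η ω))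
      (fun n => (hmeas n).nullMeasurableSet) hanti ⟨0, measure_ne_top _ _⟩
    rw [← hset, withDensity_apply _ (hH'.inter (h.measurableSet_stayForeverEvent y m))] at this
    exact this.congr fun n => withDensity_apply _ (hmeas n)
  refine tendsto_nhds_unique h1 ?_
  simp_rw [h.setLIntegral_stayEvent y _ m S hz hH hHs hf]
  refine tendsto_lintegral_of_dominated_convergence (fun _ => 1) (fun n => ?_) (fun n => ?_)
    (by simp) ?_
  · exact hfη.mul (((measurable_stayProb n S z).comp (measurable_envShift y)).comp h.envMeas)
  · filter_upwards [ae_restrict_of_ae h.envRange] with ω hω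
    have hω' : ∀ x, envShift y (η ω) x ∈ Set.Ico (1 / 2 : ℝ) 1 := fun x => hω _
    calc _ ≤ 1 * stayProb (envShift y (η ω)) 0 S z :=
          mul_le_mul' (hf1 _) (stayProb_antitone hω' S z (Nat.zero_le n))
      _ = 1 := by simp [stayProb]
  · filter_upwards [ae_restrict_of_ae h.envRange] with ω hω
    have hω' : ∀ x, envShift y (η ω) x ∈ Set.Ico (1 / 2 : ℝ) 1 := fun x => hω _
    exact ENNReal.Tendsto.const_mul (tendsto_atTop_iInf (stayProb_antitone hω' S z))
      (Or.inr (ne_top_of_le_ne_top ENNReal.one_ne_top (hf1 _)))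

omit [IsProbabilityMeasure P] in
theorem ae_env_range : ∀ᵐ e ∂(P.map η), ∀ x : ℤ, e x ∈ Set.Ico (1 / 2 : ℝ) 1 := by
  rw [ae_map_iff h.envMeas.aemeasurable]
  · exact h.envRange
  · simp only [Set.ofPred_forall]
    exact MeasurableSet.iInter fun x => measurable_pi_apply x measurableSet_Ico

/-- If survival above `0` from a fresh start is impossible, then the walk is not transient
to the right. -/
theorem measure_tendsto_atTop_eq_zero (hX0 : ∀ᵐ ω ∂P, X 0 ω = 1)
    (hshift : MeasurePreserving (envShift 1) (P.map η) (P.map η))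
    (hp : ∀ᵐ e ∂(P.map η), stayForeverProb e ∅ 0 = 0) :
    ∀ᵐ ω ∂P, ¬ Tendsto (fun n => X n ω) atTop atTop := by
  have hp1 : ∀ r : ℕ, ∀ᵐ e ∂(P.map η),
      stayForeverProb (envShift 1 e) (Set.Ico 0 (r : ℤ)) 0 = 0 := by
    intro r
    filter_upwards [hp, h.ae_env_range] with e he he'
    by_contra hne
    exact (stayForeverProb_empty_pos he' r (pos_iff_ne_zero.2 hne)).ne' he
  have hp2 : ∀ r : ℕ, ∀ᵐ ω ∂P, stayForeverProb (envShift 2 (η ω)) (Set.Ico 0 (r : ℤ)) 0 = 0 := by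
    intro r
    have h1 := hshift.quasiMeasurePreserving.ae (hp1 r)
    have h2 := ae_of_ae_map h.envMeas.aemeasurable h1
    filter_upwards [h2] with ω hω
    rwa [envShift_envShift] at hω
  let H : ℕ → ℕ → Set Ω := fun n r => {ω | X n ω = 1 ∧ (∀ j ≤ n, X j ω ≤ 1 + r) ∧
    (∃ j ≤ n, X j ω = 1 + r) ∧ X (n + 1) ω = 2 ∧
    ∀ j ≤ n, X (j + 1) ω = X j ω + 1 ∨ X (j + 1) ω = X j ω - 1}
  have hHm : ∀ n r, MeasurableSet[h.filtration (n + 1)] (H n r) := fun n r => by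
    refine h.measurableSet_of_history fun ω ω' hω => ?_
    rintro ⟨h1, h2, ⟨j, hj, h3⟩, h4, h5⟩
    refine ⟨?_, fun j hj => ?_, ⟨j, hj, ?_⟩, ?_, fun j hj => ?_⟩
    · rw [← hω n (by omega)]; exact h1
    · rw [← hω j (by omega)]; exact h2 j hj
    · rw [← hω j (by omega)]; exact h3
    · rw [← hω (n + 1) le_rfl]; exact h4
    · rw [← hω (j + 1) (by omega), ← hω j (by omega)]; exact h5 j hj
  have hHs : ∀ n r, H n r ⊆ stateEvent X 2 (n + 1) (Set.Ico 0 (r : ℤ)) 0 := by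
    rintro n r ω ⟨h1, h2, ⟨k, hk, h3⟩, h4, h5⟩
    refine ⟨by omega, fun w hw => ⟨fun hwr => ?_, fun ⟨j, hj, h6, h7⟩ => ?_⟩⟩
    · obtain ⟨-, hwr⟩ := hwr
      obtain ⟨j, -, hj, hj'⟩ := exists_downcrossing (u := fun n => X n ω) (v := 2 + w) hk
        (fun j hj => h5 j (by omega)) (by omega) (by omega)
      exact ⟨j, by omega, hj'⟩
    · have := h2 j (by omega)
      exact ⟨hw, by omega⟩
  have hnull : ∀ n r, ∀ᵐ ω ∂P, ω ∉ H n r ∩ stayForeverEvent X 2 (n + 1) := by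
    intro n r
    have h1 := h.setLIntegral_stayForeverEvent 2 (n + 1) _ le_rfl (hHm n r) (hHs n r)
      (f := fun _ => 1) measurable_const (fun _ => le_rfl)
    have h2 : ∫⁻ ω in H n r, 1 * stayForeverProb (envShift 2 (η ω)) (Set.Ico 0 (r : ℤ)) 0 ∂P
        = 0 := by
      rw [lintegral_congr_ae (g := fun _ => 0)]
      · simp
      · filter_upwards [ae_restrict_of_ae (hp2 r)] with ω hω
        simp [hω]
    rw [h2] at h1
    rw [ae_iff]
    simpa using h1
  filter_upwards [hX0, h.ae_steps, ae_all_iff.2 fun n => ae_all_iff.2 (hnull n)]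
    with ω h0 hst hn htend
  obtain ⟨N, hN⟩ := (tendsto_atTop.1 htend 2).exists_forall_of_atTop
  have hex : ∃ n ≤ N, X n ω = 1 := ⟨0, Nat.zero_le _, h0⟩
  classical
  set n := Nat.findGreatest (fun n => X n ω = 1) N with hn_def
  have h1 : X n ω = 1 := Nat.findGreatest_spec (P := fun n => X n ω = 1) (Nat.zero_le N) h0
  have h2 : ∀ j, n < j → X j ω ≠ 1 := fun j hj h3 => by
    by_cases hjN : j ≤ N
    · exact Nat.findGreatest_is_greatest hj hjN h3
    · have := hN j (by omega)
      omega
  have h3 : ∀ j, n < j → 2 ≤ X j ω := fun j hj => by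
    by_contra hcon
    obtain ⟨i, hi, -, h4, -⟩ := exists_first_hit (u := fun n => X n ω) (v := 1)
      (le_max_left j N) (fun j _ => hst j) (by omega)
      (by have := hN (max j N) (le_max_right _ _); omega)
    exact h2 i (by omega) h4
  obtain ⟨k, hk, hkmax⟩ := (Finset.range (n + 1)).exists_max_image (fun j => X j ω) (by simp)
  have hk' := Finset.mem_range.1 hk
  have hk1 := hkmax n (by simp)
  refine hn n (X k ω - 1).toNat
    ⟨⟨h1, fun j hj => ?_, ⟨k, by omega, by omega⟩, ?_, fun j _ => hst j⟩,
    fun i => h3 _ (by omega)⟩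
  · have := hkmax j (Finset.mem_range.2 (by omega))
    omega
  · have := h3 (n + 1) (by omega)
    have := hst n
    omega

theorem ae_stayForeverProb_pos (hX0 : ∀ᵐ ω ∂P, X 0 ω = 1)
    (herg : Ergodic (envShift 1) (P.map η))
    (htrans : ¬ ∀ᵐ ω ∂P, ¬ Tendsto (fun n => X n ω) atTop atTop) :
    ∀ᵐ e ∂(P.map η), 0 < stayForeverProb e ∅ 0 := by
  have : IsProbabilityMeasure (P.map η) := Measure.isProbabilityMeasure_map h.envMeas.aemeasurable
  set G : Set (ℤ → ℝ) := {e | 0 < stayForeverProb e ∅ 0} with hG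
  have hGm : MeasurableSet G := measurableSet_lt measurable_const (measurable_stayForeverProb _ _)
  have hle : envShift 1 ⁻¹' G ≤ᵐ[P.map η] G := by
    filter_upwards [h.ae_env_range] with e he hs
    refine stayForeverProb_empty_pos he 0 ?_
    have hs' : 0 < stayForeverProb (envShift 1 e) ∅ 0 := hs
    simpa using hs'
  rcases herg.ae_empty_or_univ_of_preimage_ae_le hGm.nullMeasurableSet hle with h1 | h1
  · refine absurd (h.measure_tendsto_atTop_eq_zero hX0 herg.toMeasurePreserving ?_) htrans
    filter_upwards [measure_eq_zero_iff_ae_notMem.1 (ae_eq_empty.1 h1)] with e he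
    exact not_not.1 fun hne => he (pos_iff_ne_zero.2 hne)
  · exact eventuallyEq_univ.1 h1

end IsCookieRWRE

namespace IsCookieRWRE

variable {Ω : Type*} [mΩ : MeasurableSpace Ω] {P : Measure Ω} {η : Ω → ℤ → ℝ}
  {X : ℕ → Ω → ℤ} (h : IsCookieRWRE P η X)
include h

variable [IsProbabilityMeasure P]

omit [IsProbabilityMeasure P] in
theorem ae_abs_le (hX0 : ∀ᵐ ω ∂P, X 0 ω = 1) : ∀ᵐ ω ∂P, ∀ n, |X n ω| ≤ n + 1 := by
  filter_upwards [hX0, h.ae_steps] with ω h0 hst n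
  induction n with
  | zero => simp [h0]
  | succ n ih =>
    have := hst n
    rw [abs_le] at ih ⊢
    push_cast
    omega

theorem submartingale (hX0 : ∀ᵐ ω ∂P, X 0 ω = 1) :
    Submartingale (fun n ω => (X n ω : ℝ)) h.filtration P := by
  have hmeas : ∀ n, Measurable fun ω => (X n ω : ℝ) := fun n =>
    measurable_from_top.comp (h.meas n)
  refine submartingale_of_condExp_sub_nonneg_nat (fun n => ?_) (fun n => ?_) fun n => ?_
  · exact Measurable.stronglyMeasurable (measurable_from_top.comp (h.measurable_walk le_rfl))
  · refine Integrable.of_bound (hmeas n).aestronglyMeasurable ((n : ℝ) + 1) ?_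
    filter_upwards [h.ae_abs_le hX0] with ω hω
    rw [Real.norm_eq_abs]
    exact_mod_cast hω n
  · set R : Set Ω := {ω | X (n + 1) ω = X n ω + 1} with hR
    have h1 : (fun ω => (X (n + 1) ω : ℝ)) - (fun ω => (X n ω : ℝ)) =ᵐ[P]
        (2 : ℝ) • R.indicator (fun _ => (1 : ℝ)) - fun _ => (1 : ℝ) := by
      filter_upwards [h.ae_steps] with ω hω
      rcases hω n with h2 | h2
      · have : ω ∈ R := h2
        simp [this, h2]
        norm_num
      · have : ω ∉ R := fun h3 => by
          have : X (n + 1) ω = X n ω + 1 := h3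
          omega
        simp [this, h2]
    have h2 := condExp_congr_ae (m := h.filtration n) h1
    have h3 := condExp_sub (m := h.filtration n) (μ := P)
      (f := (2 : ℝ) • R.indicator (fun _ => (1 : ℝ)))
      (((integrable_const (1 : ℝ)).indicator (h.measurableSet_right n)).smul (2 : ℝ))
      (integrable_const (1 : ℝ))
    have h4 := condExp_smul (m := h.filtration n) (μ := P) (2 : ℝ) (R.indicator (fun _ => (1 : ℝ)))
    filter_upwards [h2, h3, h4, h.condExp_right n, h.rightProb_mem] with ω h2 h3 h4 h5 h6
    rw [h2, h3, Pi.sub_apply, h4, Pi.smul_apply, h5, condExp_const (h.filtration.le n)]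
    have := (h6 n).1
    simp only [Pi.zero_apply, smul_eq_mul]
    linarith

theorem ae_not_bddAbove (hX0 : ∀ᵐ ω ∂P, X 0 ω = 1) :
    ∀ᵐ ω ∂P, ∀ k : ℤ, ∃ n, k ≤ X n ω := by
  have hsub := (h.submartingale hX0).bddAbove_iff_exists_tendsto (R := 1) (by
    filter_upwards [h.ae_steps] with ω hω n
    rcases hω n with h1 | h1 <;> simp [h1])
  filter_upwards [hsub, h.ae_steps] with ω hω hst k
  by_contra! hcon
  obtain ⟨c, hc⟩ := hω.1 ⟨(k : ℝ), by
    rintro _ ⟨n, rfl⟩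
    exact Int.cast_le.2 (hcon n).le⟩
  have h1 : Tendsto (fun n => (X (n + 1) ω : ℝ) - X n ω) atTop (nhds 0) := by
    simpa using ((tendsto_add_atTop_iff_nat 1).2 hc).sub hc
  obtain ⟨n, hn⟩ := ((Metric.tendsto_nhds.1 h1) 1 one_pos).exists
  rcases hst n with h2 | h2 <;> simp [h2] at hn

theorem ae_frequently_left (z : ℤ) :
    ∀ᵐ ω ∂P, (∃ᶠ n in atTop, X n ω = z) → ∃ᶠ n in atTop, X n ω = z - 1 := by
  let A : ℕ → Set Ω := fun n => {ω | X n ω = z}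
  let s : ℕ → Set Ω := fun n => {ω | 0 < n ∧ X (n - 1) ω = z ∧ X n ω = X (n - 1) ω - 1}
  have hs : ∀ n, MeasurableSet[h.filtration n] (s n) := fun n => by
    refine h.measurableSet_of_history fun ω ω' hω => ?_
    rintro ⟨h1, h2, h3⟩
    rw [hω (n - 1) (by omega)] at h2 h3
    rw [hω n le_rfl] at h3
    exact ⟨h1, h2, h3⟩
  have hA : ∀ n, MeasurableSet[h.filtration n] (A n) := fun n =>
    h.measurableSet_of_history fun ω ω' hω hA => by
      exact (hω n le_rfl).symm.trans hA
  have hcond : ∀ n, P[(s (n + 1)).indicator (1 : Ω → ℝ) | h.filtration n] =ᵐ[P]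
      (A n).indicator fun ω => 1 - rightProb η X n ω := by
    intro n
    have h1 : (s (n + 1)).indicator (1 : Ω → ℝ) =
        (A n).indicator (Set.indicator {ω | X (n + 1) ω = X n ω - 1} (fun _ => (1 : ℝ))) := by
      rw [Set.indicator_indicator]
      congr 1
      ext ω
      simp [s, A]
    rw [h1]
    refine (condExp_indicator ((integrable_const _).indicator (h.measurableSet_left n))
      (hA n)).trans ?_
    filter_upwards [h.condExp_left n] with ω hω
    by_cases hωA : ω ∈ A n <;> simp [hωA, hω]
  filter_upwards [ae_mem_limsup_atTop_iff P hs, ae_all_iff.2 hcond, h.envRange] with ω h1 h2 h3 hfr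
  have hlim : ω ∈ limsup s atTop := by
    rw [h1]
    simp_rw [h2]
    have hc : 0 < 1 - η ω z := by linarith [(h3 z).2]
    have hle : ∀ k, (if X k ω = z then 1 - η ω z else 0) ≤
        (A k).indicator (fun ω => 1 - rightProb η X k ω) ω := by
      intro k
      by_cases hk : X k ω = z
      · have : ω ∈ A k := hk
        rw [if_pos hk, Set.indicator_of_mem this]
        unfold rightProb
        split_ifs
        · rw [hk]
        · linarith [(h3 z).1]
      · have : ω ∉ A k := hk
        rw [if_neg hk, Set.indicator_of_notMem this]
    have hmono : Monotone fun n => ∑ k ∈ Finset.range n,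
        (if X k ω = z then 1 - η ω z else 0) := by
      refine monotone_nat_of_le_succ fun n => ?_
      rw [Finset.sum_range_succ]
      split_ifs <;> linarith
    refine tendsto_atTop_mono (fun n => Finset.sum_le_sum fun k _ => hle k) ?_
    refine tendsto_atTop_atTop_of_monotone hmono fun b => ?_
    have hunb : ∀ m : ℕ, ∃ n, m * (1 - η ω z) ≤ ∑ k ∈ Finset.range n,
        (if X k ω = z then 1 - η ω z else 0) := by
      intro m
      induction m with
      | zero => exact ⟨0, by simp⟩
      | succ m ih =>
        obtain ⟨n, hn⟩ := ih
        obtain ⟨k, hk, hk'⟩ := (frequently_atTop.1 hfr) n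
        refine ⟨k + 1, ?_⟩
        rw [Finset.sum_range_succ, if_pos hk']
        push_cast
        have := hmono hk
        simp only at this
        linarith
    obtain ⟨m, hm⟩ := exists_nat_ge (b / (1 - η ω z))
    obtain ⟨n, hn⟩ := hunb m
    exact ⟨n, ((div_le_iff₀ hc).1 hm).trans hn⟩
  rw [mem_limsup_iff_frequently_mem] at hlim
  exact hlim.mono fun n hn => by
    obtain ⟨-, h4, h5⟩ := hn
    omega

theorem ae_frequently_of_not_tendsto (hX0 : ∀ᵐ ω ∂P, X 0 ω = 1)
    (hrec : ∀ᵐ ω ∂P, ¬ Tendsto (fun n => X n ω) atTop atTop) (x : ℤ) :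
    ∀ᵐ ω ∂P, ∃ᶠ n in atTop, X n ω = x := by
  filter_upwards [hrec, h.ae_not_bddAbove hX0, h.ae_steps,
    ae_all_iff.2 fun z => h.ae_frequently_left z] with ω hω hunb hst hleft
  obtain ⟨c, hc⟩ : ∃ c, ∃ᶠ n in atTop, X n ω < c := by
    simpa [tendsto_atTop, frequently_atTop, eventually_atTop] using hω
  have hhigh : ∀ k : ℤ, ∀ a : ℕ, ∃ n ≥ a, k ≤ X n ω := by
    intro k a
    obtain ⟨M, hM⟩ := ((Finset.range a).image fun n => X n ω).bddAbove
    obtain ⟨n, hn⟩ := hunb (max k (M + 1))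
    refine ⟨n, ?_, le_trans (le_max_left _ _) hn⟩
    by_contra hna
    have h1 : X n ω ≤ M := hM (by
      simp only [Finset.coe_image, Set.mem_image, Finset.coe_range, Set.mem_Iio]
      exact ⟨n, by omega, rfl⟩)
    have := le_trans (le_max_right _ _) hn
    omega
  have hbase : ∃ᶠ n in atTop, X n ω = max c x := by
    refine frequently_atTop.2 fun a => ?_
    obtain ⟨n, hn, hn'⟩ := (frequently_atTop.1 hc) a
    obtain ⟨m, hm, hm'⟩ := hhigh (max c x) n
    obtain ⟨j, hj, -, hj', -⟩ := exists_first_hit (u := fun n => X n ω) hm (fun j _ => hst j)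
      (hn'.le.trans (le_max_left _ _)) hm'
    exact ⟨j, by omega, hj'⟩
  have hdown : ∀ k : ℕ, ∃ᶠ n in atTop, X n ω = max c x - k := by
    intro k
    induction k with
    | zero => simpa using hbase
    | succ k ih =>
      have := hleft _ ih
      push_cast
      rwa [← sub_sub]
  have := hdown (max c x - x).toNat
  rwa [Int.toNat_of_nonneg (by omega), sub_sub_cancel] at this

end IsCookieRWRE

/-- The drift accumulated at the site `x` in the environment `e` before the first jump to the
left, that is `e x / (1 - e x) - 1`. -/
def excess (e : ℤ → ℝ) (x : ℤ) : ℝ := (2 * e x - 1) / (1 - e x)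

theorem measurable_excess (x : ℤ) : Measurable fun e => excess e x :=
  (((measurable_pi_apply x).const_mul 2).sub_const 1).div ((measurable_pi_apply x).const_sub 1)

/-- The event that the walk stays in the open interval `(a, b)` up to time `n`. -/
def insideEvent {Ω : Type*} (X : ℕ → Ω → ℤ) (a b : ℤ) (n : ℕ) : Set Ω :=
  {ω | ∀ j ≤ n, a < X j ω ∧ X j ω < b}

/-- The event that the walk jumps to the left from `x` before leaving `(a, b)`. -/
def leftJumpEvent {Ω : Type*} (X : ℕ → Ω → ℤ) (a b x : ℤ) : Set Ω :=
  {ω | ∃ n, ω ∈ insideEvent X a b n ∧ X n ω = x ∧ X (n + 1) ω = x - 1}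

open Classical in
/-- The walk stopped when it leaves the interval `(a, b)`. -/
def stoppedWalk {Ω : Type*} (X : ℕ → Ω → ℤ) (a b : ℤ) : ℕ → Ω → ℤ
  | 0, ω => X 0 ω
  | n + 1, ω => if ω ∈ insideEvent X a b n then X (n + 1) ω else stoppedWalk X a b n ω

theorem insideEvent_or_stoppedWalk_eq {Ω : Type*} {X : ℕ → Ω → ℤ} {a b : ℤ} (hb : 1 < b) {ω : Ω}
    (h0 : X 0 ω = 1) (hst : ∀ n, X (n + 1) ω = X n ω + 1 ∨ X (n + 1) ω = X n ω - 1)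
    (hB : ∀ n, a < X n ω) (n : ℕ) :
    ω ∈ insideEvent X a b n ∨ stoppedWalk X a b n ω = b := by
  induction n with
  | zero =>
    left
    intro j hj
    obtain rfl : j = 0 := by omega
    exact ⟨hB 0, by omega⟩
  | succ n ih =>
    by_cases hn : ω ∈ insideEvent X a b n
    · have h1 := (hn n le_rfl).2
      have h2 := hst n
      by_cases h3 : X (n + 1) ω < b
      · left
        intro j hj
        rcases hj.eq_or_lt with rfl | hj
        · exact ⟨hB _, h3⟩
        · exact hn j (by omega)
      · right
        rw [stoppedWalk, if_pos hn]
        omega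
    · right
      rw [stoppedWalk, if_neg hn]
      exact ih.resolve_left hn

open Classical in
theorem sum_indicator_le_sum_leftJumpEvent {Ω : Type*} {X : ℕ → Ω → ℤ} {a b : ℤ}
    (g : ℤ → ENNReal) (ω : Ω) (N : ℕ) :
    ∑ n ∈ Finset.range N, (insideEvent X a b n ∩ freshEvent X n ∩
        {ω | X (n + 1) ω = X n ω - 1}).indicator (fun ω => g (X n ω)) ω ≤
      ∑ x ∈ Finset.Ioo a b, (leftJumpEvent X a b x).indicator (fun _ => g x) ω := by
  simp only [Set.indicator_apply]
  rw [← Finset.sum_filter, ← Finset.sum_filter]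
  set s := (Finset.range N).filter fun n => ω ∈ insideEvent X a b n ∩ freshEvent X n ∩
    {ω | X (n + 1) ω = X n ω - 1} with hs
  have hinj : Set.InjOn (fun n => X n ω) s := by
    have key : ∀ n n', n ∈ s → n' ∈ s → X n ω = X n' ω → ¬ n < n' := by
      intro n n' hn hn' heq hlt
      have h1 := (Finset.mem_filter.1 hn).2
      have h2 := (Finset.mem_filter.1 hn').2
      exact h2.1.2 n hlt ⟨heq, h1.2⟩
    intro n hn n' hn' heq
    have h1 := key n n' hn hn' heq
    have h2 := key n' n hn' hn heq.symm
    omega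
  rw [← Finset.sum_image (f := g) (g := fun n => X n ω) hinj]
  refine Finset.sum_le_sum_of_subset fun x hx => ?_
  obtain ⟨n, hn, rfl⟩ := Finset.mem_image.1 hx
  have h1 := (Finset.mem_filter.1 hn).2
  have h2 := h1.1.1 n le_rfl
  exact Finset.mem_filter.2 ⟨Finset.mem_Ioo.2 h2, n, h1.1.1, rfl, h1.2⟩

namespace IsCookieRWRE

variable {Ω : Type*} [mΩ : MeasurableSpace Ω] {P : Measure Ω} {η : Ω → ℤ → ℝ}
  {X : ℕ → Ω → ℤ} (h : IsCookieRWRE P η X)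
include h

theorem measurableSet_insideEvent (a b : ℤ) (n : ℕ) :
    MeasurableSet[h.filtration n] (insideEvent X a b n) :=
  h.measurableSet_of_history fun ω ω' hω hs j hj => by
    rw [← hω j hj]
    exact hs j hj

theorem measurableSet_leftJumpEvent (a b x : ℤ) : MeasurableSet (leftJumpEvent X a b x) := by
  simp only [leftJumpEvent, Set.ofPred_exists]
  refine MeasurableSet.iUnion fun n => ?_
  refine (h.filtration.le n _ (h.measurableSet_insideEvent a b n)).inter ?_
  exact (measurableSet_eq_fun (h.meas _) measurable_const).inter
    (measurableSet_eq_fun (h.meas _) measurable_const)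

theorem measurableSet_forall_lt (a : ℤ) : MeasurableSet {ω | ∀ n, a < X n ω} := by
  simp only [Set.ofPred_forall]
  exact MeasurableSet.iInter fun n => measurableSet_lt measurable_const (h.meas n)

variable [IsProbabilityMeasure P]

theorem setLIntegral_insideEvent_succ (a b : ℤ) (n : ℕ) :
    ∫⁻ ω in insideEvent X a b n, ENNReal.ofReal ((X (n + 1) ω : ℝ) - a) ∂P =
      ∫⁻ ω in insideEvent X a b n, ENNReal.ofReal ((X n ω : ℝ) - a) ∂P +
      ∫⁻ ω in insideEvent X a b n ∩ freshEvent X n ∩ {ω | X (n + 1) ω = X n ω - 1},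
        ENNReal.ofReal (excess (η ω) (X n ω)) ∂P := by
  have hle := h.filtration.le n
  set I := insideEvent X a b n with hI
  have hIm : MeasurableSet[h.filtration n] I := h.measurableSet_insideEvent a b n
  have hFm := h.measurableSet_freshEvent n
  set R : Set Ω := {ω | X (n + 1) ω = X n ω + 1} with hR
  set L : Set Ω := {ω | X (n + 1) ω = X n ω - 1} with hL
  have hXm : Measurable[h.filtration n] fun ω => (X n ω : ℝ) :=
    measurable_from_top.comp (h.measurable_walk le_rfl)
  have hpm := h.measurable_rightProb n
  have hsplit : (I : Set Ω) =ᵐ[P] ((I ∩ R) ∪ (I ∩ L) : Set Ω) := by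
    filter_upwards [h.ae_steps] with ω hω
    refine propext ⟨fun hs => ?_, fun hs => ?_⟩
    · rcases hω n with h2 | h2
      · exact Or.inl ⟨hs, h2⟩
      · exact Or.inr ⟨hs, h2⟩
    · rcases hs with hs | hs <;> exact hs.1
  have hdisj : Disjoint (I ∩ R) (I ∩ L) := by
    refine Set.disjoint_left.2 fun ω h1 h2 => ?_
    have h3 : X (n + 1) ω = X n ω + 1 := h1.2
    have h4 : X (n + 1) ω = X n ω - 1 := h2.2
    omega
  have hRint : ∫⁻ ω in I ∩ R, ENNReal.ofReal ((X (n + 1) ω : ℝ) - a) ∂P =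
      ∫⁻ ω in I, ENNReal.ofReal ((X n ω : ℝ) + 1 - a) * ENNReal.ofReal (rightProb η X n ω) ∂P := by
    rw [← h.setLIntegral_right n hIm (Measurable.ennreal_ofReal ((hXm.add_const 1).sub_const _))]
    refine setLIntegral_congr_fun ((hle _ hIm).inter (h.measurableSet_right n)) fun ω hω => ?_
    have h2 : X (n + 1) ω = X n ω + 1 := hω.2
    simp [h2]
  have hLint : ∫⁻ ω in I ∩ L, ENNReal.ofReal ((X (n + 1) ω : ℝ) - a) ∂P =
      ∫⁻ ω in I, ENNReal.ofReal ((X n ω : ℝ) - 1 - a) *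
        ENNReal.ofReal (1 - rightProb η X n ω) ∂P := by
    rw [← h.setLIntegral_left n hIm (Measurable.ennreal_ofReal ((hXm.sub_const 1).sub_const _))]
    refine setLIntegral_congr_fun ((hle _ hIm).inter (h.measurableSet_left n)) fun ω hω => ?_
    have h2 : X (n + 1) ω = X n ω - 1 := hω.2
    simp [h2]
  have hexm : Measurable[h.filtration n] fun ω => ENNReal.ofReal (excess (η ω) (X n ω)) := by
    refine Measurable.ennreal_ofReal ?_
    have h1 : Measurable[h.filtration n] fun ω => η ω (X n ω) :=
      measurable_eval_comp (h.measurable_env n) (h.measurable_walk le_rfl)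
    exact ((h1.const_mul 2).sub_const 1).div (h1.const_sub 1)
  have hfresh : ∫⁻ ω in I ∩ freshEvent X n ∩ L, ENNReal.ofReal (excess (η ω) (X n ω)) ∂P =
      ∫⁻ ω in I, ENNReal.ofReal (2 * rightProb η X n ω - 1) ∂P := by
    rw [h.setLIntegral_left n (hIm.inter hFm) hexm, Set.inter_comm,
      ← setLIntegral_indicator (hle _ hFm)]
    refine setLIntegral_congr_fun_ae (hle _ hIm) ?_
    filter_upwards [h.envRange] with ω hω _
    by_cases hf : ω ∈ freshEvent X n
    · have h1 := hω (X n ω)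
      rw [Set.indicator_of_mem hf, rightProb, if_pos hf, excess,
        ← ENNReal.ofReal_mul (div_nonneg (by linarith [h1.1]) (by linarith [h1.2])),
        div_mul_cancel₀ _ (by linarith [h1.2])]
    · rw [Set.indicator_of_notMem hf, rightProb, if_neg hf]
      simp
  rw [setLIntegral_congr hsplit, lintegral_union ((hle _ hIm).inter (h.measurableSet_left n)) hdisj,
    hRint, hLint, hfresh, ← lintegral_add_left, ← lintegral_add_left]
  · refine setLIntegral_congr_fun_ae (hle _ hIm) ?_
    filter_upwards [h.rightProb_mem] with ω hω hωI
    have h1 := hω n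
    have h2 : (a : ℝ) + 1 ≤ X n ω := by exact_mod_cast (hωI n le_rfl).1
    rw [← ENNReal.ofReal_mul (by linarith), ← ENNReal.ofReal_mul (by linarith),
      ← ENNReal.ofReal_add (mul_nonneg (by linarith) (by linarith [h1.1]))
        (mul_nonneg (by linarith) (by linarith [h1.2])),
      ← ENNReal.ofReal_add (by linarith) (by linarith [h1.1])]
    congr 1
    ring
  · exact (Measurable.ennreal_ofReal (hXm.sub_const _)).mono hle le_rfl
  · exact Measurable.mono ((Measurable.ennreal_ofReal ((hXm.add_const 1).sub_const _)).mul
      hpm.ennreal_ofReal) hle le_rfl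

theorem lintegral_stoppedWalk (a b : ℤ) (hX0 : ∀ᵐ ω ∂P, X 0 ω = 1) (N : ℕ) :
    ∫⁻ ω, ENNReal.ofReal ((stoppedWalk X a b N ω : ℝ) - a) ∂P =
      ENNReal.ofReal (1 - a) + ∑ n ∈ Finset.range N,
        ∫⁻ ω in insideEvent X a b n ∩ freshEvent X n ∩ {ω | X (n + 1) ω = X n ω - 1},
          ENNReal.ofReal (excess (η ω) (X n ω)) ∂P := by
  induction N with
  | zero =>
    have h1 : ∀ᵐ ω ∂P, ENNReal.ofReal ((stoppedWalk X a b 0 ω : ℝ) - a) =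
        ENNReal.ofReal (1 - a) := by
      filter_upwards [hX0] with ω hω
      simp [stoppedWalk, hω]
    simp [lintegral_congr_ae h1]
  | succ N ih =>
    have hIm := h.filtration.le N _ (h.measurableSet_insideEvent a b N)
    have hwalk : ∀ n, ∀ ω ∈ insideEvent X a b n, stoppedWalk X a b n ω = X n ω := by
      rintro (_ | n) ω hω
      · rfl
      · exact if_pos fun j hj => hω j (by omega)
    rw [Finset.sum_range_succ, ← add_assoc, ← ih, ← lintegral_add_compl _ hIm,
      ← lintegral_add_compl (fun ω => ENNReal.ofReal ((stoppedWalk X a b N ω : ℝ) - a)) hIm]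
    have h1 : ∫⁻ ω in insideEvent X a b N, ENNReal.ofReal ((stoppedWalk X a b (N + 1) ω : ℝ) - a) ∂P
        = ∫⁻ ω in insideEvent X a b N, ENNReal.ofReal ((X (N + 1) ω : ℝ) - a) ∂P :=
      setLIntegral_congr_fun hIm fun ω hω => by simp [stoppedWalk, hω]
    have h2 : ∫⁻ ω in insideEvent X a b N, ENNReal.ofReal ((stoppedWalk X a b N ω : ℝ) - a) ∂P
        = ∫⁻ ω in insideEvent X a b N, ENNReal.ofReal ((X N ω : ℝ) - a) ∂P :=
      setLIntegral_congr_fun hIm fun ω hω => by simp [hwalk N ω hω]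
    have h3 : ∫⁻ ω in (insideEvent X a b N)ᶜ,
          ENNReal.ofReal ((stoppedWalk X a b (N + 1) ω : ℝ) - a) ∂P
        = ∫⁻ ω in (insideEvent X a b N)ᶜ, ENNReal.ofReal ((stoppedWalk X a b N ω : ℝ) - a) ∂P :=
      setLIntegral_congr_fun hIm.compl fun ω hω => by
        have : ω ∉ insideEvent X a b N := hω
        simp [stoppedWalk, this]
    rw [h1, h2, h3, h.setLIntegral_insideEvent_succ, add_right_comm]

theorem mul_measure_forall_lt_le (hX0 : ∀ᵐ ω ∂P, X 0 ω = 1)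
    (hunb : ∀ᵐ ω ∂P, ∀ k : ℤ, ∃ n, k ≤ X n ω) {a b : ℤ} (hb : 1 < b) :
    ENNReal.ofReal (b - a) * P {ω | ∀ n, a < X n ω} ≤ ENNReal.ofReal (1 - a) +
      ∑ x ∈ Finset.Ioo a b, ∫⁻ ω in leftJumpEvent X a b x,
        ENNReal.ofReal (excess (η ω) x) ∂P := by
  let B : ℕ → Set Ω := fun N => {ω | ∀ n, a < X n ω} ∩ {ω | ∃ n ≤ N, b ≤ X n ω}
  have hBm : ∀ N, MeasurableSet {ω | ∃ n ≤ N, b ≤ X n ω} := fun N =>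
    _root_.measurableSet_of_history (n := N) (fun j _ => h.meas j) fun ω ω' hω ⟨n, hn, hn'⟩ =>
      ⟨n, hn, by rwa [← hω n hn]⟩
  have hB : Tendsto (fun N => P (B N)) atTop (nhds (P {ω | ∀ n, a < X n ω})) := by
    have h1 : ({ω | ∀ n, a < X n ω} : Set Ω) =ᵐ[P] (⋃ N, B N : Set Ω) := by
      filter_upwards [hunb] with ω hω
      refine propext ⟨fun hs => ?_, fun hs => ?_⟩
      · obtain ⟨n, hn⟩ := hω b
        exact Set.mem_iUnion.2 ⟨n, hs, n, le_rfl, hn⟩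
      · obtain ⟨n, hn⟩ := Set.mem_iUnion.1 hs
        exact hn.1
    rw [measure_congr h1]
    exact tendsto_measure_iUnion_atTop fun N N' hN ω ⟨h2, n, hn, hn'⟩ =>
      ⟨h2, n, hn.trans hN, hn'⟩
  refine le_of_tendsto' (ENNReal.Tendsto.const_mul hB (Or.inr ENNReal.ofReal_ne_top)) fun N => ?_
  have hexm : ∀ x, Measurable fun ω => ENNReal.ofReal (excess (η ω) x) := fun x =>
    ((measurable_excess x).comp h.envMeas).ennreal_ofReal
  have hXm : ∀ n, Measurable fun ω => ENNReal.ofReal (excess (η ω) (X n ω)) := fun n =>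
    have h1 : Measurable fun ω => η ω (X n ω) := measurable_eval_comp h.envMeas (h.meas n)
    Measurable.ennreal_ofReal (((h1.const_mul 2).sub_const 1).div (h1.const_sub 1))
  calc ENNReal.ofReal (b - a) * P (B N)
      = ∫⁻ _ in B N, ENNReal.ofReal (b - a) ∂P := by simp
    _ = ∫⁻ ω in B N, ENNReal.ofReal ((stoppedWalk X a b N ω : ℝ) - a) ∂P := by
        refine setLIntegral_congr_fun_ae ((h.measurableSet_forall_lt a).inter (hBm N)) ?_
        filter_upwards [hX0, h.ae_steps] with ω h0 hst ⟨h1, n, hn, hn'⟩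
        rw [(insideEvent_or_stoppedWalk_eq hb h0 hst h1 N).resolve_left fun h2 => ?_]
        have := (h2 n hn).2
        omega
    _ ≤ ∫⁻ ω, ENNReal.ofReal ((stoppedWalk X a b N ω : ℝ) - a) ∂P := setLIntegral_le_lintegral _ _
    _ = _ := h.lintegral_stoppedWalk a b hX0 N
    _ ≤ _ := by
        gcongr
        have hm : ∀ n, MeasurableSet (insideEvent X a b n ∩ freshEvent X n ∩
            {ω | X (n + 1) ω = X n ω - 1}) := fun n =>
          ((h.filtration.le n _ (h.measurableSet_insideEvent a b n)).inter
            (h.filtration.le n _ (h.measurableSet_freshEvent n))).inter (h.measurableSet_left n)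
        simp_rw [← lintegral_indicator (hm _), ← lintegral_indicator
          (h.measurableSet_leftJumpEvent a b _)]
        rw [← lintegral_finsetSum _ fun n _ => (hXm n).indicator (hm n),
          ← lintegral_finsetSum _ fun x _ =>
            (hexm x).indicator (h.measurableSet_leftJumpEvent a b x)]
        exact lintegral_mono fun ω =>
          sum_indicator_le_sum_leftJumpEvent (fun x => ENNReal.ofReal (excess (η ω) x)) ω N

end IsCookieRWRE

/-- The event that the walk hits `x` for the first time at time `m`, staying above `a` until
then. -/
def firstHitEvent {Ω : Type*} (X : ℕ → Ω → ℤ) (a x : ℤ) (m : ℕ) : Set Ω :=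
  {ω | X m ω = x ∧ ∀ j < m, a < X j ω ∧ X j ω < x}

/-- The event that the walk stays above `a` as long as it has not reached `x`. -/
def aboveBeforeEvent {Ω : Type*} (X : ℕ → Ω → ℤ) (a x : ℤ) : Set Ω :=
  {ω | ∀ n, (∀ j ≤ n, X j ω < x) → a < X n ω}

theorem excess_nonneg {e : ℤ → ℝ} (he : ∀ x, e x ∈ Set.Ico (1 / 2 : ℝ) 1) (x : ℤ) :
    0 ≤ excess e x :=
  div_nonneg (by linarith [(he x).1]) (by linarith [(he x).2])

theorem excess_envShift (e : ℤ → ℝ) (x y : ℤ) : excess (envShift y e) x = excess e (x + y) := rfl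

/-- The expected excess retained by a walk that never returns below the site it starts from. -/
def retainedExcess (e : ℤ → ℝ) : ENNReal :=
  min (ENNReal.ofReal (excess e 0)) 1 * stayForeverProb e ∅ 0

theorem measurable_retainedExcess : Measurable retainedExcess :=
  ((measurable_excess 0).ennreal_ofReal.min measurable_const).mul
    (measurable_stayForeverProb ∅ 0)

theorem retainedExcess_le_one (e : ℤ → ℝ) : retainedExcess e ≤ 1 :=
  mul_le_one' (min_le_right _ _) (stayForeverProb_le_one _ _ _)

theorem lintegral_excess_eq {μ : Measure (ℤ → ℝ)} (hμ : MeasurePreserving (envShift 1) μ μ)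
    (x : ℤ) : ∫⁻ e, ENNReal.ofReal (excess e x) ∂μ = ∫⁻ e, ENNReal.ofReal (excess e 0) ∂μ := by
  have hstep : ∀ y, ∫⁻ e, ENNReal.ofReal (excess e (y + 1)) ∂μ =
      ∫⁻ e, ENNReal.ofReal (excess e y) ∂μ := fun y => by
    rw [← hμ.lintegral_comp (measurable_excess y).ennreal_ofReal]
    rfl
  induction x using Int.induction_on with
  | zero => rfl
  | succ n ih => rw [hstep, ih]
  | pred n ih => rw [← ih, ← hstep, sub_add_cancel]

namespace IsCookieRWRE

variable {Ω : Type*} [mΩ : MeasurableSpace Ω] {P : Measure Ω} {η : Ω → ℤ → ℝ}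
  {X : ℕ → Ω → ℤ} (h : IsCookieRWRE P η X)
include h

theorem measurableSet_firstHitEvent (a x : ℤ) (m : ℕ) :
    MeasurableSet[h.filtration m] (firstHitEvent X a x m) :=
  h.measurableSet_of_history fun ω ω' hω hs => by
    refine ⟨by rw [← hω m le_rfl]; exact hs.1, fun j hj => ?_⟩
    rw [← hω j hj.le]
    exact hs.2 j hj

theorem measurableSet_aboveBeforeEvent (a x : ℤ) : MeasurableSet (aboveBeforeEvent X a x) := by
  simp only [aboveBeforeEvent, Set.ofPred_forall]
  refine MeasurableSet.iInter fun n => ?_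
  refine _root_.measurableSet_of_history (n := n) (fun j _ => h.meas j) fun ω ω' hω hs hs' => ?_
  rw [← hω n le_rfl]
  exact hs fun j hj => by rw [hω j hj]; exact hs' j hj

theorem lintegral_excess_le_one (hshift : MeasurePreserving (envShift 1) (P.map η) (P.map η))
    (hexp : ∫⁻ e, ENNReal.ofReal (excess e 0) ∂(P.map η) ≤ 1) (x : ℤ) :
    ∫⁻ ω, ENNReal.ofReal (excess (η ω) x) ∂P ≤ 1 := by
  rw [← lintegral_excess_eq hshift x, lintegral_map (measurable_excess x).ennreal_ofReal
    h.envMeas] at hexp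
  exact hexp

variable [IsProbabilityMeasure P]

theorem lintegral_leftJumpEvent_add_le (hX0 : ∀ᵐ ω ∂P, X 0 ω = 1)
    (hunb : ∀ᵐ ω ∂P, ∀ k : ℤ, ∃ n, k ≤ X n ω) (a b : ℤ) {x : ℤ} (hx : 1 ≤ x) :
    ∫⁻ ω in leftJumpEvent X a b x, ENNReal.ofReal (excess (η ω) x) ∂P +
        ∫⁻ ω in {ω | ∀ n, a < X n ω}, retainedExcess (envShift x (η ω)) ∂P ≤
      ∫⁻ ω in aboveBeforeEvent X a x, ENNReal.ofReal (excess (η ω) x) ∂P := by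
  set Q := leftJumpEvent X a b x with hQ
  let H : ℕ → Set Ω := firstHitEvent X a x
  have hHm : ∀ m, MeasurableSet (H m) := fun m =>
    h.filtration.le m _ (h.measurableSet_firstHitEvent a x m)
  have hHd : Pairwise (Function.onFun Disjoint H) := by
    have key : ∀ m m', m < m' → Disjoint (H m) (H m') := fun m m' hm => by
      refine Set.disjoint_left.2 fun ω h1 h2 => ?_
      have := (h2.2 m hm).2
      have := h1.1
      omega
    intro m m' hm
    rcases hm.lt_or_gt with hm | hm
    · exact key _ _ hm
    · exact (key _ _ hm).symm
  have hHC : (⋃ m, H m) ⊆ aboveBeforeEvent X a x := by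
    intro ω hω n hn
    obtain ⟨m, h1, h2⟩ := Set.mem_iUnion.1 hω
    by_cases hmn : m ≤ n
    · have := hn m hmn
      omega
    · exact (h2 n (by omega)).1
  let V : ℕ → Set Ω := fun m => H m ∩ stayForeverEvent X x m
  have hVm : ∀ m, MeasurableSet (V m) := fun m =>
    (hHm m).inter (h.measurableSet_stayForeverEvent x m)
  have hVd : Pairwise (Function.onFun Disjoint V) := fun m m' hm =>
    (hHd hm).mono Set.inter_subset_left Set.inter_subset_left
  have hBH : ({ω | ∀ n, a < X n ω} : Set Ω) ≤ᵐ[P] (⋃ m, H m : Set Ω) := by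
    filter_upwards [hX0, hunb, h.ae_steps] with ω h0 hω hst hB
    obtain ⟨n, hn⟩ := hω x
    obtain ⟨m, -, -, h1, h2⟩ := exists_first_hit (u := fun n => X n ω) (Nat.zero_le n)
      (fun j _ => hst j) (by rw [h0]; exact hx) hn
    exact Set.mem_iUnion.2 ⟨m, h1, fun j hj => ⟨hB j, h2 j (Nat.zero_le j) hj⟩⟩
  have hQH : Q ≤ᵐ[P] (⋃ m, H m : Set Ω) := by
    filter_upwards [hX0, h.ae_steps] with ω h0 hst hωQ
    obtain ⟨n, h1, h2, -⟩ := hωQ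
    obtain ⟨m, -, hmn, h3, h4⟩ := exists_first_hit (u := fun n => X n ω) (Nat.zero_le n)
      (fun j _ => hst j) (by rw [h0]; exact hx) h2.ge
    exact Set.mem_iUnion.2 ⟨m, h3, fun j hj => ⟨(h1 j (by omega)).1, h4 j (Nat.zero_le j) hj⟩⟩
  have hQV : Disjoint Q (⋃ m, V m) := by
    refine Set.disjoint_left.2 fun ω hωQ hωV => ?_
    obtain ⟨n, -, h2, h3⟩ := hωQ
    obtain ⟨m, ⟨-, h4⟩, h5⟩ := Set.mem_iUnion.1 hωV
    have hmn : m ≤ n := by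
      by_contra hcon
      have := (h4 n (by omega)).2
      omega
    have := h5 (n + 1 - m)
    rw [show m + (n + 1 - m) = n + 1 by omega] at this
    omega
  have hret : ∫⁻ ω in {ω | ∀ n, a < X n ω}, retainedExcess (envShift x (η ω)) ∂P ≤
      ∫⁻ ω in ⋃ m, V m, ENNReal.ofReal (excess (η ω) x) ∂P := by
    calc _ ≤ ∫⁻ ω in ⋃ m, H m, retainedExcess (envShift x (η ω)) ∂P :=
          lintegral_mono' (Measure.restrict_mono_ae hBH) le_rfl
      _ = ∑' m, ∫⁻ ω in H m, retainedExcess (envShift x (η ω)) ∂P :=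
          lintegral_iUnion hHm hHd _
      _ = ∑' m, ∫⁻ ω in V m, min (ENNReal.ofReal (excess (η ω) x)) 1 ∂P := by
          refine tsum_congr fun m => ?_
          rw [h.setLIntegral_stayForeverEvent x m ∅ le_rfl (h.measurableSet_firstHitEvent a x m) ?_
            (f := fun e => min (ENNReal.ofReal (excess e x)) 1)
            ((measurable_excess x).ennreal_ofReal.min measurable_const) (fun e => min_le_right _ _)]
          · simp only [retainedExcess, excess_envShift, zero_add]
            rfl
          · rintro ω ⟨h1, h2⟩
            refine ⟨by omega, fun w hw => ⟨fun hw' => absurd hw' (Set.notMem_empty w), ?_⟩⟩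
            rintro ⟨j, hj, h3, -⟩
            have := (h2 j hj).2
            omega
      _ = ∫⁻ ω in ⋃ m, V m, min (ENNReal.ofReal (excess (η ω) x)) 1 ∂P :=
          (lintegral_iUnion hVm hVd _).symm
      _ ≤ _ := lintegral_mono fun ω => min_le_left _ _
  calc _ ≤ ∫⁻ ω in Q, ENNReal.ofReal (excess (η ω) x) ∂P +
          ∫⁻ ω in ⋃ m, V m, ENNReal.ofReal (excess (η ω) x) ∂P := by gcongr
    _ = ∫⁻ ω in Q ∪ ⋃ m, V m, ENNReal.ofReal (excess (η ω) x) ∂P :=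
        (lintegral_union (MeasurableSet.iUnion hVm) hQV).symm
    _ ≤ ∫⁻ ω in ⋃ m, H m, ENNReal.ofReal (excess (η ω) x) ∂P := by
        refine lintegral_mono' (Measure.restrict_mono_ae ?_) le_rfl
        filter_upwards [hQH] with ω hω hω'
        rcases hω' with hω' | hω'
        · exact hω hω'
        · exact Set.iUnion_mono (fun m => Set.inter_subset_left) hω'
    _ ≤ _ := lintegral_mono' (Measure.restrict_mono hHC le_rfl) le_rfl

theorem mul_measure_add_sum_retainedExcess_le (hX0 : ∀ᵐ ω ∂P, X 0 ω = 1)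
    (hunb : ∀ᵐ ω ∂P, ∀ k : ℤ, ∃ n, k ≤ X n ω)
    (hshift : MeasurePreserving (envShift 1) (P.map η) (P.map η))
    (hexp : ∫⁻ e, ENNReal.ofReal (excess e 0) ∂(P.map η) ≤ 1) (L : ℕ) {N : ℕ} (hN : 1 ≤ N) :
    N * P {ω | ∀ n, -(L : ℤ) < X n ω} + ∑ i ∈ Finset.range N,
        ∫⁻ ω in {ω | ∀ n, -(L : ℤ) < X n ω}, retainedExcess (envShift (i + 1) (η ω)) ∂P ≤
      (1 + 2 * L) + ∑ i ∈ Finset.range N, ∫⁻ ω in aboveBeforeEvent X (-L) (i + 1),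
        ENNReal.ofReal (excess (envShift (i + 1) (η ω)) 0) ∂P := by
  set B : Set Ω := {ω | ∀ n, -(L : ℤ) < X n ω} with hB
  set q : ℤ → ENNReal := fun x => ∫⁻ ω in leftJumpEvent X (-L) (N + 1) x,
    ENNReal.ofReal (excess (η ω) x) ∂P with hq
  have h1 := h.mul_measure_forall_lt_le hX0 hunb (a := -L) (b := N + 1) (by omega)
  have h2 : ∑ x ∈ Finset.Ioo (-(L : ℤ)) (N + 1), q x =
      ∑ x ∈ Finset.Ioc (-(L : ℤ)) 0, q x + ∑ i ∈ Finset.range N, q (i + 1) := by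
    have h3 : Finset.Ioo (-(L : ℤ)) (N + 1) =
        Finset.Ioc (-(L : ℤ)) 0 ∪ (Finset.range N).image fun i : ℕ => (i : ℤ) + 1 := by
      ext x
      simp only [Finset.mem_Ioo, Finset.mem_union, Finset.mem_Ioc, Finset.mem_image,
        Finset.mem_range]
      constructor
      · intro hx
        by_cases hx0 : x ≤ 0
        · exact Or.inl ⟨hx.1, hx0⟩
        · exact Or.inr ⟨(x - 1).toNat, by omega, by omega⟩
      · rintro (hx | ⟨i, hi, rfl⟩) <;> omega
    have h4 : Disjoint (Finset.Ioc (-(L : ℤ)) 0)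
        ((Finset.range N).image fun i : ℕ => (i : ℤ) + 1) := by
      refine Finset.disjoint_left.2 fun x hx hx' => ?_
      obtain ⟨i, -, rfl⟩ := Finset.mem_image.1 hx'
      have := (Finset.mem_Ioc.1 hx).2
      omega
    rw [h3, Finset.sum_union h4, Finset.sum_image fun i _ j _ hij => by simpa using hij]
  have h3 : ∑ x ∈ Finset.Ioc (-(L : ℤ)) 0, q x ≤ L := by
    calc ∑ x ∈ Finset.Ioc (-(L : ℤ)) 0, q x ≤ ∑ x ∈ Finset.Ioc (-(L : ℤ)) 0, 1 :=
          Finset.sum_le_sum fun x _ =>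
            (setLIntegral_le_lintegral _ _).trans (h.lintegral_excess_le_one hshift hexp x)
      _ = L := by simp
  have h4 : (N : ENNReal) * P B ≤ (1 + L) + (L + ∑ i ∈ Finset.range N, q (i + 1)) := by
    calc (N : ENNReal) * P B ≤ ENNReal.ofReal (((N + 1 : ℤ) : ℝ) - ((-L : ℤ) : ℝ)) * P B := by
          gcongr
          rw [← ENNReal.ofReal_natCast]
          refine ENNReal.ofReal_le_ofReal ?_
          push_cast
          linarith [Nat.cast_nonneg (α := ℝ) L]
      _ ≤ _ := h1
      _ ≤ _ := by
          rw [h2]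
          gcongr
          refine (ENNReal.ofReal_le_ofReal (q := ((1 + L : ℕ) : ℝ)) ?_).trans ?_
          · push_cast; linarith
          · rw [ENNReal.ofReal_natCast]; push_cast; rfl
  calc _ ≤ (1 + L) + (L + ∑ i ∈ Finset.range N, q (i + 1)) + ∑ i ∈ Finset.range N,
        ∫⁻ ω in B, retainedExcess (envShift (i + 1) (η ω)) ∂P := by gcongr
    _ = (1 + 2 * L) + ∑ i ∈ Finset.range N, (q (i + 1) +
        ∫⁻ ω in B, retainedExcess (envShift (i + 1) (η ω)) ∂P) := by
        rw [Finset.sum_add_distrib]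
        ring
    _ ≤ _ := by
        gcongr with i hi
        simp only [excess_envShift, zero_add]
        exact h.lintegral_leftJumpEvent_add_le hX0 hunb _ _ (by omega)

theorem tendsto_measure_aboveBeforeEvent (a : ℤ) :
    Tendsto (fun i : ℕ => P (aboveBeforeEvent X a (i + 1))) atTop
      (nhds (P {ω | ∀ n, a < X n ω})) := by
  have hset : ({ω | ∀ n, a < X n ω} : Set Ω) = ⋂ i : ℕ, aboveBeforeEvent X a (i + 1) := by
    ext ω
    refine ⟨fun hω => Set.mem_iInter.2 fun i n _ => hω n, fun hω n => ?_⟩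
    obtain ⟨M, hM⟩ := ((Finset.range (n + 1)).image fun n => X n ω).bddAbove
    refine Set.mem_iInter.1 hω M.toNat n fun j hj => ?_
    have : X j ω ≤ M := hM (by
      simp only [Finset.coe_image, Set.mem_image, Finset.coe_range, Set.mem_Iio]
      exact ⟨j, by omega, rfl⟩)
    omega
  rw [hset]
  refine tendsto_measure_iInter_atTop
    (fun i => (h.measurableSet_aboveBeforeEvent a _).nullMeasurableSet) ?_ ⟨0, measure_ne_top _ _⟩
  intro i j hij ω hω n hn
  exact hω n fun k hk => (hn k hk).trans_le (by omega)

end IsCookieRWRE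

/-- The nonnegative part of the excess at the origin. -/
def posExcess (e : ℤ → ℝ) : ℝ := max (excess e 0) 0

theorem measurable_posExcess : Measurable posExcess := (measurable_excess 0).max measurable_const

theorem posExcess_nonneg (e : ℤ → ℝ) : 0 ≤ posExcess e := le_max_right _ _

theorem ofReal_posExcess (e : ℤ → ℝ) :
    ENNReal.ofReal (posExcess e) = ENNReal.ofReal (excess e 0) := by
  rcases le_total (excess e 0) 0 with h | h
  · simp [posExcess, h, ENNReal.ofReal_of_nonpos]
  · simp [posExcess, h]

theorem abs_min_posExcess_le (M : ℕ) (e : ℤ → ℝ) : |min (posExcess e) M| ≤ M := by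
  rw [abs_of_nonneg (le_min (posExcess_nonneg e) (Nat.cast_nonneg M))]
  exact min_le_right _ _

theorem measurable_min_posExcess (M : ℕ) : Measurable fun e => min (posExcess e) (M : ℝ) :=
  measurable_posExcess.min measurable_const

theorem integrable_posExcess {μ : Measure (ℤ → ℝ)}
    (hexp : ∫⁻ e, ENNReal.ofReal (excess e 0) ∂μ ≤ 1) : Integrable posExcess μ := by
  refine ⟨measurable_posExcess.aestronglyMeasurable, ?_⟩
  rw [hasFiniteIntegral_iff_ofReal (Eventually.of_forall posExcess_nonneg)]
  simp_rw [ofReal_posExcess]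
  exact hexp.trans_lt ENNReal.one_lt_top

theorem integral_posExcess_le_one {μ : Measure (ℤ → ℝ)}
    (hexp : ∫⁻ e, ENNReal.ofReal (excess e 0) ∂μ ≤ 1) : ∫ e, posExcess e ∂μ ≤ 1 := by
  rw [integral_eq_lintegral_of_nonneg_ae (Eventually.of_forall posExcess_nonneg)
    measurable_posExcess.aestronglyMeasurable]
  simp_rw [ofReal_posExcess]
  exact ENNReal.toReal_le_of_le_ofReal zero_le_one (by simpa using hexp)

theorem measurePreserving_envShift {μ : Measure (ℤ → ℝ)}
    (hμ : MeasurePreserving (envShift 1) μ μ) (i : ℕ) : MeasurePreserving (envShift i) μ μ := by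
  have h1 : envShift i = (envShift 1)^[i] := funext fun e => (iterate_shift_eq_envShift i e).symm
  rw [h1]
  exact hμ.iterate i

theorem integral_comp_envShift {μ : Measure (ℤ → ℝ)} (hμ : MeasurePreserving (envShift 1) μ μ)
    (i : ℕ) {φ : (ℤ → ℝ) → ℝ} (hφ : Measurable φ) :
    ∫ e, φ (envShift i e) ∂μ = ∫ e, φ e ∂μ := by
  have h1 := measurePreserving_envShift hμ i
  rw [← integral_map h1.aemeasurable hφ.aestronglyMeasurable, h1.map_eq]

theorem tendsto_integral_min_posExcess {μ : Measure (ℤ → ℝ)} (hposint : Integrable posExcess μ) :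
    Tendsto (fun M : ℕ => ∫ e, min (posExcess e) (M : ℝ) ∂μ) atTop
      (nhds (∫ e, posExcess e ∂μ)) := by
  refine tendsto_integral_of_dominated_convergence posExcess
    (fun M => (measurable_min_posExcess M).aestronglyMeasurable) hposint
    (fun M => Eventually.of_forall fun e => ?_) (Eventually.of_forall fun e => ?_)
  · rw [Real.norm_eq_abs, abs_of_nonneg (le_min (posExcess_nonneg e) (Nat.cast_nonneg M))]
    exact min_le_left _ _
  · obtain ⟨M, hM⟩ := exists_nat_ge (posExcess e)
    refine tendsto_atTop_of_eventually_const (i₀ := M) fun k hk => min_eq_left (hM.trans ?_)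
    exact_mod_cast hk

namespace IsCookieRWRE

variable {Ω : Type*} [mΩ : MeasurableSpace Ω] {P : Measure Ω} {η : Ω → ℤ → ℝ}
  {X : ℕ → Ω → ℤ} (h : IsCookieRWRE P η X)
include h

variable [IsProbabilityMeasure P]

theorem tendsto_average_setIntegral_envShift (herg : Ergodic (envShift 1) (P.map η))
    {φ : (ℤ → ℝ) → ℝ} (hφ : Measurable φ) {M : ℝ} (hM : ∀ e, |φ e| ≤ M) {B : Set Ω}
    (hB : MeasurableSet B) :
    Tendsto (fun N : ℕ => (N : ℝ)⁻¹ *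
        ∑ i ∈ Finset.range N, ∫ ω in B, φ (envShift (i + 1) (η ω)) ∂P) atTop
      (nhds (P.real B * ∫ e, φ e ∂(P.map η))) := by
  have h1 := tendsto_average_setIntegral_comp_iterate h.envMeas herg
    (hφ.comp (measurable_envShift 1)) (fun e => hM _) hB
  have h2 : ∀ (i : ℕ) e, φ (envShift 1 ((envShift 1)^[i] e)) = φ (envShift (i + 1) e) := by
    intro i e
    rw [show (envShift 1)^[i] e = envShift i e from iterate_shift_eq_envShift i e,
      envShift_envShift, add_comm]
  have h3 := integral_comp_envShift herg.toMeasurePreserving 1 hφ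
  simp only [Function.comp_def, h2] at h1
  rwa [show ∫ e, φ (envShift 1 e) ∂(P.map η) = ∫ e, φ e ∂(P.map η) from h3] at h1

theorem setLIntegral_excess_le (hshift : MeasurePreserving (envShift 1) (P.map η) (P.map η))
    (hposint : Integrable posExcess (P.map η)) {B C : Set Ω} (hB : MeasurableSet B)
    (hC : MeasurableSet C) (hBC : B ⊆ C) (M i : ℕ) :
    ∫⁻ ω in C, ENNReal.ofReal (excess (envShift (i + 1) (η ω)) 0) ∂P ≤
      ENNReal.ofReal (∫ ω in B, min (posExcess (envShift (i + 1) (η ω))) (M : ℝ) ∂P +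
        M * (P.real C - P.real B) +
        (∫ e, posExcess e ∂(P.map η) - ∫ e, min (posExcess e) (M : ℝ) ∂(P.map η))) := by
  have hmp := measurePreserving_envShift hshift (i + 1)
  push_cast at hmp
  have hηmp : MeasurePreserving η P (P.map η) := ⟨h.envMeas, rfl⟩
  have hmp' : MeasurePreserving (fun ω => envShift (i + 1) (η ω)) P (P.map η) := hmp.comp hηmp
  have hi1 : Integrable (fun ω => posExcess (envShift (i + 1) (η ω))) P :=
    hmp'.integrable_comp_of_integrable hposint
  have hmM : Integrable (fun e => min (posExcess e) (M : ℝ)) (P.map η) :=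
    hposint.mono (measurable_min_posExcess M).aestronglyMeasurable <|
      Eventually.of_forall fun e => by
      rw [Real.norm_eq_abs, Real.norm_eq_abs, abs_of_nonneg (posExcess_nonneg e),
        abs_of_nonneg (le_min (posExcess_nonneg e) (Nat.cast_nonneg M))]
      exact min_le_left _ _
  have hi2 : Integrable (fun ω => min (posExcess (envShift (i + 1) (η ω))) (M : ℝ)) P :=
    hmp'.integrable_comp_of_integrable hmM
  simp_rw [← ofReal_posExcess]
  rw [← ofReal_integral_eq_lintegral_ofReal hi1.integrableOn
    (Eventually.of_forall fun ω => posExcess_nonneg _)]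
  refine ENNReal.ofReal_le_ofReal ?_
  have h1 : ∫ ω in C, posExcess (envShift (i + 1) (η ω)) ∂P =
      ∫ ω in C, min (posExcess (envShift (i + 1) (η ω))) (M : ℝ) ∂P +
      ∫ ω in C, (posExcess (envShift (i + 1) (η ω)) -
        min (posExcess (envShift (i + 1) (η ω))) (M : ℝ)) ∂P := by
    rw [integral_sub hi1.integrableOn hi2.integrableOn]
    ring
  have h2 : ∫ ω in C, (posExcess (envShift (i + 1) (η ω)) -
        min (posExcess (envShift (i + 1) (η ω))) (M : ℝ)) ∂P ≤
      ∫ e, posExcess e ∂(P.map η) - ∫ e, min (posExcess e) (M : ℝ) ∂(P.map η) := by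
    refine (setIntegral_le_integral (hi1.sub hi2) (Eventually.of_forall fun ω =>
      sub_nonneg.2 (min_le_left _ _))).trans_eq ?_
    have h3 := integral_map hmp'.aemeasurable (f := posExcess)
      measurable_posExcess.aestronglyMeasurable
    have h4 := integral_map hmp'.aemeasurable (f := fun e => min (posExcess e) (M : ℝ))
      (measurable_min_posExcess M).aestronglyMeasurable
    rw [hmp'.map_eq] at h3 h4
    rw [integral_sub' hi1 hi2, h3, h4]
  have h3 : ∫ ω in C, min (posExcess (envShift (i + 1) (η ω))) (M : ℝ) ∂P ≤
      ∫ ω in B, min (posExcess (envShift (i + 1) (η ω))) (M : ℝ) ∂P +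
        M * (P.real C - P.real B) := by
    have h4 := setIntegral_union (Set.disjoint_sdiff_right (s := B) (t := C)) (hC.diff hB)
      hi2.integrableOn hi2.integrableOn
    rw [Set.union_sdiff_cancel hBC] at h4
    rw [h4, ← measureReal_sdiff hBC hB]
    gcongr
    calc ∫ ω in C \ B, min (posExcess (envShift (i + 1) (η ω))) (M : ℝ) ∂P
        ≤ ∫ ω in C \ B, (M : ℝ) ∂P :=
          setIntegral_mono hi2.integrableOn (integrable_const _).integrableOn
            fun ω => min_le_right _ _
      _ = M * P.real (C \ B) := by simp [mul_comm]
  linarith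

theorem ae_not_tendsto_atTop (hX0 : ∀ᵐ ω ∂P, X 0 ω = 1)
    (herg : Ergodic (envShift 1) (P.map η))
    (hexp : ∫⁻ e, ENNReal.ofReal (excess e 0) ∂(P.map η) ≤ 1) :
    ∀ᵐ ω ∂P, ¬ Tendsto (fun n => X n ω) atTop atTop := by
  by_contra htrans
  have hunb := h.ae_not_bddAbove hX0
  have hμ : IsProbabilityMeasure (P.map η) :=
    Measure.isProbabilityMeasure_map h.envMeas.aemeasurable
  have hshift := herg.toMeasurePreserving
  have hposint := integrable_posExcess hexp
  obtain ⟨L, hL⟩ : ∃ L : ℕ, P {ω | ∀ n, -(L : ℤ) < X n ω} ≠ 0 := by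
    by_contra! hcon
    refine htrans ?_
    filter_upwards [ae_all_iff.2 fun L => measure_eq_zero_iff_ae_notMem.1 (hcon L)] with ω hω htend
    obtain ⟨M, hM⟩ := bddBelow_range_of_tendsto_atTop_atTop htend
    refine hω (1 - M).toNat fun n => ?_
    have : M ≤ X n ω := hM ⟨n, rfl⟩
    omega
  set B : Set Ω := {ω | ∀ n, -(L : ℤ) < X n ω} with hB
  have hBm : MeasurableSet B := h.measurableSet_forall_lt _
  set b := P.real B with hb
  have hb0 : 0 < b := ENNReal.toReal_pos hL (measure_ne_top _ _)
  set φ : (ℤ → ℝ) → ℝ := fun e => (retainedExcess e).toReal with hφ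
  have hφm : Measurable φ := measurable_retainedExcess.ennreal_toReal
  have hφ1 : ∀ e, |φ e| ≤ 1 := fun e => by
    rw [abs_of_nonneg ENNReal.toReal_nonneg]
    exact ENNReal.toReal_le_of_le_ofReal zero_le_one (by simpa using retainedExcess_le_one e)
  have hφof : ∀ e, ENNReal.ofReal (φ e) = retainedExcess e := fun e =>
    ENNReal.ofReal_toReal (ne_top_of_le_ne_top ENNReal.one_ne_top (retainedExcess_le_one e))
  have hφi : Integrable φ (P.map η) := Integrable.of_bound hφm.aestronglyMeasurable 1
    (Eventually.of_forall hφ1)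
  set c : ℕ → ℝ := fun i => P.real (aboveBeforeEvent X (-(L : ℤ)) (i + 1)) with hc
  have hc0 : Tendsto (fun i => c i - b) atTop (nhds 0) := by
    have h1 : Tendsto c atTop (nhds b) := (ENNReal.tendsto_toReal (measure_ne_top P B)).comp
      (h.tendsto_measure_aboveBeforeEvent (-(L : ℤ)))
    simpa using h1.sub_const b
  have hBC : ∀ x, B ⊆ aboveBeforeEvent X (-(L : ℤ)) x := fun x ω hω n _ => hω n
  set m := ∫ e, posExcess e ∂(P.map η) with hm
  have hmain : ∀ M N : ℕ, 1 ≤ N → N * b + ∑ i ∈ Finset.range N,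
        ∫ ω in B, φ (envShift (i + 1) (η ω)) ∂P ≤ (1 + 2 * L) + ∑ i ∈ Finset.range N,
        (∫ ω in B, min (posExcess (envShift (i + 1) (η ω))) (M : ℝ) ∂P + M * (c i - b) +
          (m - ∫ e, min (posExcess e) (M : ℝ) ∂(P.map η))) := by
    intro M N hN
    have h1 := h.mul_measure_add_sum_retainedExcess_le hX0 hunb hshift hexp L hN
    have h2 : ∀ i : ℕ, ∫⁻ ω in B, retainedExcess (envShift (i + 1) (η ω)) ∂P =
        ENNReal.ofReal (∫ ω in B, φ (envShift (i + 1) (η ω)) ∂P) := fun i => by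
      rw [ofReal_integral_eq_lintegral_ofReal _ (Eventually.of_forall fun ω =>
        ENNReal.toReal_nonneg)]
      · exact lintegral_congr fun ω => (hφof _).symm
      · exact Integrable.of_bound
          ((hφm.comp (measurable_envShift _)).comp h.envMeas).aestronglyMeasurable 1
          (Eventually.of_forall fun ω => hφ1 _)
    have hs0 : ∀ i : ℕ, 0 ≤ ∫ ω in B, φ (envShift (i + 1) (η ω)) ∂P := fun i =>
      integral_nonneg fun ω => ENNReal.toReal_nonneg
    have hmM : ∫ e, min (posExcess e) (M : ℝ) ∂(P.map η) ≤ m :=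
      integral_mono_of_nonneg (Eventually.of_forall fun e =>
        le_min (posExcess_nonneg e) (Nat.cast_nonneg M)) hposint
        (Eventually.of_forall fun e => min_le_left _ _)
    have ht0 : ∀ i : ℕ, 0 ≤ ∫ ω in B, min (posExcess (envShift (i + 1) (η ω))) (M : ℝ) ∂P +
        M * (c i - b) + (m - ∫ e, min (posExcess e) (M : ℝ) ∂(P.map η)) := fun i => by
      have h3 : b ≤ c i := measureReal_mono (hBC _)
      have h4 : 0 ≤ ∫ ω in B, min (posExcess (envShift (i + 1) (η ω))) (M : ℝ) ∂P :=
        integral_nonneg fun ω => le_min (posExcess_nonneg _) (Nat.cast_nonneg M)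
      have h5 : 0 ≤ (M : ℝ) * (c i - b) := mul_nonneg (Nat.cast_nonneg M) (by linarith)
      linarith
    have h3 := h1.trans (add_le_add le_rfl (Finset.sum_le_sum fun i _ =>
      h.setLIntegral_excess_le hshift hposint hBm (h.measurableSet_aboveBeforeEvent _ _)
        (hBC (i + 1)) M i))
    simp_rw [← hB, h2] at h3
    rw [← ENNReal.ofReal_sum_of_nonneg fun i _ => hs0 i,
      ← ENNReal.ofReal_sum_of_nonneg fun i _ => ht0 i] at h3
    have h4 : (N : ENNReal) * P B = ENNReal.ofReal (N * b) := by
      rw [ENNReal.ofReal_mul (Nat.cast_nonneg N), ENNReal.ofReal_natCast, hb, ofReal_measureReal]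
    have h5 : (1 + 2 * L : ENNReal) = ENNReal.ofReal (1 + 2 * L) := by
      rw [show (1 + 2 * L : ℝ) = ((1 + 2 * L : ℕ) : ℝ) by push_cast; ring, ENNReal.ofReal_natCast]
      push_cast
      ring
    rw [h4, h5, ← ENNReal.ofReal_add (by positivity) (Finset.sum_nonneg fun i _ => hs0 i),
      ← ENNReal.ofReal_add (by positivity) (Finset.sum_nonneg fun i _ => ht0 i)] at h3
    exact (ENNReal.ofReal_le_ofReal_iff
      (add_nonneg (by positivity) (Finset.sum_nonneg fun i _ => ht0 i))).1 h3
  have hlim : ∀ M : ℕ, b + b * ∫ e, φ e ∂(P.map η) ≤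
      b * ∫ e, min (posExcess e) (M : ℝ) ∂(P.map η) +
        (m - ∫ e, min (posExcess e) (M : ℝ) ∂(P.map η)) := by
    intro M
    have h1 := (h.tendsto_average_setIntegral_envShift herg hφm hφ1 hBm).const_add b
    have h2 := h.tendsto_average_setIntegral_envShift herg (measurable_min_posExcess M)
      (abs_min_posExcess_le M) hBm
    have h3 := hc0.cesaro.const_mul (M : ℝ)
    have h4 := (tendsto_inv_atTop_nhds_zero_nat (𝕜 := ℝ)).mul_const (1 + 2 * (L : ℝ))
    have h5 := ((h4.add h2).add h3).add_const
      (m - ∫ e, min (posExcess e) (M : ℝ) ∂(P.map η))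
    rw [zero_mul, zero_add, mul_zero, add_zero] at h5
    refine le_of_tendsto_of_tendsto h1 h5 ?_
    filter_upwards [eventually_ge_atTop 1] with N hN
    have hN0 : (0 : ℝ) < N := by exact_mod_cast hN
    have h6 := mul_le_mul_of_nonneg_left (hmain M N hN) (inv_nonneg.2 hN0.le)
    rw [Finset.sum_add_distrib, Finset.sum_add_distrib, ← Finset.mul_sum, Finset.sum_const,
      Finset.card_range, nsmul_eq_mul] at h6
    have h7 : (N : ℝ)⁻¹ * N = 1 := inv_mul_cancel₀ hN0.ne'
    have h8 : ∀ u, (N : ℝ)⁻¹ * (N * u) = u := fun u => by rw [← mul_assoc, h7, one_mul]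
    have h9 : ∀ u v, (N : ℝ)⁻¹ * (N * u + v) = u + (N : ℝ)⁻¹ * v := fun u v => by
      rw [mul_add, h8]
    have h10 : ∀ u v w z, (N : ℝ)⁻¹ * (u + (v + M * w + N * z)) =
        (N : ℝ)⁻¹ * u + (N : ℝ)⁻¹ * v + M * ((N : ℝ)⁻¹ * w) + z := fun u v w z => by
      rw [mul_add, mul_add, mul_add, h8]
      ring
    rw [h9] at h6
    refine h6.trans_eq ?_
    rw [← h10]
  have hle : b + b * ∫ e, φ e ∂(P.map η) ≤ b * m := by
    have h1 := tendsto_integral_min_posExcess hposint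
    have h2 := (h1.const_mul b).add (h1.const_sub m)
    rw [← hm, sub_self, add_zero] at h2
    exact ge_of_tendsto' h2 hlim
  have hm1 : m ≤ 1 := integral_posExcess_le_one hexp
  have hφ0 : ∫ e, φ e ∂(P.map η) = 0 := by
    refine le_antisymm ?_ (integral_nonneg fun e => ENNReal.toReal_nonneg)
    by_contra! hpos
    nlinarith [mul_pos hb0 hpos]
  have hm0 : m = 0 := by
    refine integral_eq_zero_of_ae ?_
    rw [integral_eq_zero_iff_of_nonneg (fun e => ENNReal.toReal_nonneg) hφi] at hφ0
    filter_upwards [hφ0, h.ae_stayForeverProb_pos hX0 herg htrans] with e h1 h2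
    have h3 : retainedExcess e = 0 := by
      rw [← hφof]
      exact (congrArg ENNReal.ofReal h1).trans ENNReal.ofReal_zero
    rcases mul_eq_zero.1 h3 with h4 | h4
    · rcases min_eq_bot.1 h4 with h5 | h5
      · have h6 : excess e 0 ≤ 0 := ENNReal.ofReal_eq_zero.1 h5
        simpa [posExcess] using h6
      · simp at h5
    · exact absurd h4 h2.ne'
  rw [hφ0, hm0] at hle
  linarith

end IsCookieRWRE

theorem lintegral_excess_le_one_of_le_two {μ : Measure (ℤ → ℝ)} [IsProbabilityMeasure μ]
    (hμ : ∀ᵐ e ∂μ, ∀ x : ℤ, e x ∈ Set.Ico (1 / 2 : ℝ) 1)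
    (hexp : ∫⁻ e, ENNReal.ofReal (e 0 / (1 - e 0)) ∂μ ≤ 2) :
    ∫⁻ e, ENNReal.ofReal (excess e 0) ∂μ ≤ 1 := by
  have h1 : ∫⁻ e, ENNReal.ofReal (e 0 / (1 - e 0)) ∂μ =
      ∫⁻ e, ENNReal.ofReal (excess e 0) ∂μ + 1 := by
    calc _ = ∫⁻ e, (ENNReal.ofReal (excess e 0) + 1) ∂μ := by
          refine lintegral_congr_ae ?_
          filter_upwards [hμ] with e he
          have h2 := he 0
          rw [← ENNReal.ofReal_one, ← ENNReal.ofReal_add (excess_nonneg he 0) zero_le_one, excess]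
          congr 1
          have : 1 - e 0 ≠ 0 := by linarith [h2.2]
          field_simp
          ring
      _ = _ := by rw [lintegral_add_right _ measurable_const]; simp
  rw [h1, ← one_add_one_eq_two] at hexp
  exact (ENNReal.add_le_add_iff_right ENNReal.one_ne_top).1 hexp

/-- In a stationary ergodic environment with `E[ω(0)/(1-ω(0))] ≤ 2`, the walk is recurrent:
it visits every site infinitely often almost surely. -/
theorem stmt7 {Ω : Type*} [MeasurableSpace Ω] (P : Measure Ω) [IsProbabilityMeasure P]
    (η : Ω → ℤ → ℝ) (X : ℕ → Ω → ℤ) (h : IsCookieRWRE P η X)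
    (hX0 : ∀ᵐ ω ∂P, X 0 ω = 1)
    (herg : Ergodic (fun ω : ℤ → ℝ => fun x => ω (x + 1)) (P.map η))
    (hexp : ∫⁻ ω, ENNReal.ofReal (ω 0 / (1 - ω 0)) ∂(P.map η) ≤ 2) :
    ∀ x : ℤ, ∀ᵐ ω ∂P, ∃ᶠ n in atTop, X n ω = x := by
  have : IsProbabilityMeasure (P.map η) := Measure.isProbabilityMeasure_map h.envMeas.aemeasurable
  exact h.ae_frequently_of_not_tendsto hX0 (h.ae_not_tendsto_atTop hX0 herg
    (lintegral_excess_le_one_of_le_two h.ae_env_range hexp))
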